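/- arXiv:1007.4248 — 8 statements merged into one kernel-verified Lean document; each statement's English description precedes it below -/
import Mathlib

section
/- Let A be a unital C*-algebra and let a, b, x ∈ A satisfy 0 ≤ a ≤ b ≤ 1 (inequalities in the positive cone of A). Then ‖x − b·x‖² ≤ ‖x‖ · ‖x − a·x‖. -/
/-- In a unital C*-algebra `A`, if `0 ≤ a ≤ b ≤ 1`, then
`‖x − b·x‖² ≤ ‖x‖ · ‖x − a·x‖` for every `x ∈ A`. -/
theorem stmt2 {A : Type*} [CStarAlgebra A] [PartialOrder A] [StarOrderedRing A]
    (a b x : A) (ha : 0 ≤ a) (hab : a ≤ b) (hb1 : b ≤ 1) :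
    ‖x - b * x‖ ^ 2 ≤ ‖x‖ * ‖x - a * x‖ := by
  have hc : 0 ≤ 1 - b := sub_nonneg.2 hb1
  have hc1 : 1 - b ≤ 1 := sub_le_self 1 (ha.trans hab)
  have hsq : (1 - b) ^ 2 ≤ 1 - b := by
    simpa using CStarAlgebra.pow_antitone hc hc1 one_le_two
  have hle : (1 - b) ^ 2 ≤ 1 - a := hsq.trans (sub_le_sub_left hab 1)
  have heq : star (x - b * x) * (x - b * x) = star x * (1 - b) ^ 2 * x := by
    rw [← one_sub_mul, star_mul, (IsSelfAdjoint.of_nonneg hc).star_eq, sq]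
    simp only [mul_assoc]
  calc ‖x - b * x‖ ^ 2 = ‖star (x - b * x) * (x - b * x)‖ := by
        rw [CStarRing.norm_star_mul_self, sq]
    _ ≤ ‖star x * (1 - a) * x‖ :=
        CStarAlgebra.norm_le_norm_of_nonneg_of_le (star_mul_self_nonneg _)
          (heq ▸ star_left_conjugate_le_conjugate hle x)
    _ = ‖star x * (x - a * x)‖ := by rw [mul_assoc, one_sub_mul]
    _ ≤ ‖x‖ * ‖x - a * x‖ := by simpa using norm_mul_le (star x) (x - a * x)
end

section
/- Let B be a C*-algebra, I a closed two-sided ideal of B, and ψ a bounded positive linear functional on I that is tracial, i.e. ψ(xy) = ψ(yx) for all x, y ∈ I. Let (e_λ)_{λ} be an approximate unit of I. Then for every b ∈ B the net (ψ(b e_λ))_λ converges; the resulting functional ψ̄ on B defined by ψ̄(b) = lim_λ ψ(b e_λ) is a bounded positive linear functional on B extending ψ (it does not depend on the choice of approximate unit), and ψ̄ is tracial: ψ̄(bc) = ψ̄(cb) for all b, c ∈ B. -/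
open scoped ComplexOrder
open Filter

section IdealFunctional

variable {B : Type*} [NonUnitalCStarAlgebra B] {I : Submodule ℂ B} {φ : B →ₗ[ℂ] ℂ}

theorem conj_apply_star_mul_of_nonneg
    (hpos : ∀ x ∈ I, 0 ≤ φ (star x * x)) {x y : B} (hx : x ∈ I) (hy : y ∈ I) :
    starRingEnd ℂ (φ (star y * x)) = φ (star x * y) := by
  have im_zero : ∀ z ∈ I, (φ (star z * z)).im = 0 := fun z hz =>
    ((Complex.le_def.1 (hpos z hz)).2).symm
  have h1 := im_zero _ (I.add_mem hx hy)
  have h2 := im_zero _ (I.add_mem hx (I.smul_mem Complex.I hy))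
  have hx0 := im_zero x hx
  have hy0 := im_zero y hy
  simp only [star_add, star_smul, mul_add, add_mul, smul_mul_assoc, mul_smul_comm, map_add,
    map_smul, Complex.add_im, smul_eq_mul, Complex.mul_im, Complex.mul_re, Complex.I_re,
    Complex.I_im, Complex.star_def, Complex.conj_re, Complex.conj_im] at h1 h2
  apply Complex.ext
  · simp only [Complex.conj_re]
    linarith
  · simp only [Complex.conj_im]
    linarith

/-- The semi-inner product `⟪x, y⟫ = φ (x⋆ y)` on `I`. -/
noncomputable abbrev gnsPreCore (hpos : ∀ x ∈ I, 0 ≤ φ (star x * x)) :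
    PreInnerProductSpace.Core ℂ I where
  inner x y := φ (star (x : B) * (y : B))
  conj_inner_symm x y := conj_apply_star_mul_of_nonneg hpos x.2 y.2
  re_inner_nonneg x := (Complex.le_def.1 (hpos x x.2)).1
  add_left x y z := by simp [add_mul]
  smul_left x y r := by simp [smul_mul_assoc]

theorem norm_apply_star_mul_sq_le (hpos : ∀ x ∈ I, 0 ≤ φ (star x * x)) {x y : B}
    (hx : x ∈ I) (hy : y ∈ I) :
    ‖φ (star x * y)‖ ^ 2 ≤ (φ (star x * x)).re * (φ (star y * y)).re := by
  have h := @InnerProductSpace.Core.inner_mul_inner_self_le ℂ I _ _ _ (gnsPreCore hpos)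
    ⟨x, hx⟩ ⟨y, hy⟩
  change ‖φ (star x * y)‖ * ‖φ (star y * x)‖ ≤ _ at h
  rw [← conj_apply_star_mul_of_nonneg hpos hy hx, RCLike.norm_conj, ← pow_two] at h
  exact h

theorem tendsto_apply_of_mem {C : ℝ} (hC : ∀ x ∈ I, ‖φ x‖ ≤ C * ‖x‖) {ι : Type*}
    {L : Filter ι} {x : ι → B} {a : B} (hx : ∀ i, x i ∈ I) (ha : a ∈ I)
    (h : Tendsto x L (nhds a)) : Tendsto (fun i => φ (x i)) L (nhds (φ a)) := by
  rw [tendsto_iff_norm_sub_tendsto_zero] at h ⊢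
  refine squeeze_zero (fun _ => norm_nonneg _) (fun i => ?_) (by simpa using h.const_mul C)
  rw [← map_sub]
  exact hC _ (I.sub_mem (hx i) ha)

/-- A bounded positive functional on an ideal is approximately invariant under left
multiplication by a suitable element of the ideal, uniformly on bounded sets. -/
theorem exists_norm_apply_sub_mul_le {C : ℝ} (hC0 : 0 ≤ C) (hC : ∀ x ∈ I, ‖φ x‖ ≤ C * ‖x‖)
    (hl : ∀ b x : B, x ∈ I → b * x ∈ I) (hpos : ∀ x ∈ I, 0 ≤ φ (star x * x))
    {ι : Type*} {L : Filter ι} [L.NeBot] {e : ι → B} (he : ∀ i, e i ∈ I)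
    (he_star : ∀ i, star (e i) = e i) (he_norm : ∀ i, ‖e i‖ ≤ 1)
    (he_left : ∀ x ∈ I, Tendsto (fun i => e i * x) L (nhds x))
    (he_right : ∀ x ∈ I, Tendsto (fun i => x * e i) L (nhds x))
    {ε : ℝ} (hε : 0 < ε) : ∃ f ∈ I, ∀ x ∈ I, ‖φ (x - f * x)‖ ≤ ε * ‖x‖ := by
  set S : Set ℝ := {r | ∃ g ∈ I, ‖g‖ ≤ 1 ∧ r = (φ (star g * g)).re}
  have re_le : ∀ g ∈ I, (φ (star g * g)).re ≤ C * ‖g‖ ^ 2 := fun g hg => by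
    have := (Complex.re_le_norm _).trans (hC _ (hl (star g) g hg))
    rwa [CStarRing.norm_star_mul_self, ← pow_two] at this
  have hbdd : BddAbove S := by
    refine ⟨C, ?_⟩
    rintro r ⟨g, hg, hg1, rfl⟩
    exact (re_le g hg).trans (mul_le_of_le_one_right hC0 (pow_le_one₀ (norm_nonneg _) hg1))
  have hne : S.Nonempty := ⟨_, 0, I.zero_mem, by simp, rfl⟩
  set M := sSup S
  have le_M : ∀ g ∈ I, ‖g‖ ≤ 1 → (φ (star g * g)).re ≤ M := fun g hg hg1 =>
    le_csSup hbdd ⟨g, hg, hg1, rfl⟩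
  have hδ : 0 < ε ^ 2 / (2 * (C + 1)) := by positivity
  obtain ⟨_, ⟨g, hg, hg1, rfl⟩, hgM⟩ := exists_lt_of_lt_csSup hne (sub_lt_self M hδ)
  set f := star g * g with hf
  have hfI : f ∈ I := hl _ _ hg
  have hf_star : star f = f := by simp [hf]
  have hf1 : ‖f‖ ≤ 1 := by
    rw [CStarRing.norm_star_mul_self]
    exact mul_le_one₀ hg1 (norm_nonneg _) hg1
  refine ⟨f, hfI, fun x hx => ?_⟩
  have hfM : (φ (f * f)).re ≤ M := by simpa [hf_star] using le_M f hfI hf1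
  have key : ∀ i, ‖φ (e i * x - f * x)‖ ^ 2 ≤
      (2 * M - (φ (e i * f)).re - (φ (f * e i)).re) * (C * ‖x‖ ^ 2) := fun i => by
    have hu := I.sub_mem (he i) hfI
    have h := norm_apply_star_mul_sq_le hpos hu hx
    have hu0 : 0 ≤ (φ (star x * x)).re := (Complex.le_def.1 (hpos x hx)).1
    have hv0 : 0 ≤ (φ (star (e i - f) * (e i - f))).re := (Complex.le_def.1 (hpos _ hu)).1
    have heM := le_M (e i) (he i) (he_norm i)
    have h2 := re_le x hx
    rw [star_sub, hf_star, he_star] at h hv0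
    rw [he_star] at heM
    rw [← sub_mul]
    refine h.trans (mul_le_mul ?_ h2 hu0 ?_)
    · simp only [sub_mul, mul_sub, map_sub, Complex.sub_re]
      linarith
    · simp only [sub_mul, mul_sub, map_sub, Complex.sub_re] at hv0
      linarith
  have lim1 : Tendsto (fun i => φ (e i * x - f * x)) L (nhds (φ (x - f * x))) :=
    tendsto_apply_of_mem hC (fun i => I.sub_mem (hl _ _ hx) (hl _ _ hx))
      (I.sub_mem hx (hl _ _ hx)) ((he_left x hx).sub_const _)
  have lim2 := tendsto_apply_of_mem hC (fun i => hl (e i) f hfI) hfI (he_left f hfI)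
  have lim3 := tendsto_apply_of_mem hC (fun i => hl f (e i) (he i)) hfI (he_right f hfI)
  have hlim := le_of_tendsto_of_tendsto' (lim1.norm.pow 2)
    (((((Complex.continuous_re.tendsto _).comp lim2).const_sub (2 * M)).sub
      ((Complex.continuous_re.tendsto _).comp lim3)).mul_const (C * ‖x‖ ^ 2)) key
  refine le_of_sq_le_sq ?_ (by positivity)
  refine hlim.trans ?_
  have h4 : 2 * M - (φ f).re - (φ f).re ≤ ε ^ 2 / (C + 1) := by
    have : ε ^ 2 / (C + 1) = 2 * (ε ^ 2 / (2 * (C + 1))) := by field_simp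
    linarith
  calc _ ≤ ε ^ 2 / (C + 1) * (C * ‖x‖ ^ 2) := by gcongr
    _ = (C / (C + 1)) * (ε ^ 2 * ‖x‖ ^ 2) := by ring
    _ ≤ 1 * (ε ^ 2 * ‖x‖ ^ 2) := by
      gcongr
      exact div_le_one_of_le₀ (by linarith) (by linarith)
    _ = (ε * ‖x‖) ^ 2 := by ring

theorem exists_tendsto_apply {C : ℝ} (hC : ∀ x ∈ I, ‖φ x‖ ≤ C * ‖x‖)
    (hl : ∀ b x : B, x ∈ I → b * x ∈ I) (hr : ∀ b x : B, x ∈ I → x * b ∈ I)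
    (happrox : ∀ ε : ℝ, 0 < ε → ∃ f ∈ I, ∀ x ∈ I, ‖φ (x - f * x)‖ ≤ ε * ‖x‖)
    {ι : Type*} {L : Filter ι} [L.NeBot] {x : ι → B} (hx : ∀ i, x i ∈ I) {K : ℝ}
    (hK : ∀ i, ‖x i‖ ≤ K) {d : B}
    (hlim : ∀ f ∈ I, Tendsto (fun i => f * x i) L (nhds (f * d))) :
    ∃ a, Tendsto (fun i => φ (x i)) L (nhds a) := by
  have hc : Cauchy (map (fun i => φ (x i)) L) := by
    refine Metric.cauchy_iff.2 ⟨inferInstance, fun ε hε => ?_⟩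
    have hK0 : 0 < |K| + 1 := by positivity
    obtain ⟨f, hf, hfx⟩ := happrox (ε / 4 / (|K| + 1)) (by positivity)
    refine ⟨Metric.ball (φ (f * d)) (ε / 2), ?_, fun y hy z hz => ?_⟩
    · have h := tendsto_apply_of_mem hC (fun i => hl f _ (hx i)) (hr d f hf) (hlim f hf)
      rw [mem_map]
      filter_upwards [h.eventually (Metric.ball_mem_nhds _ (show 0 < ε / 4 by positivity))]
        with i hi
      have h1 : ‖φ (x i - f * x i)‖ ≤ ε / 4 := by
        refine (hfx _ (hx i)).trans ?_
        rw [div_mul_eq_mul_div, div_le_iff₀ hK0]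
        gcongr
        exact (hK i).trans ((le_abs_self K).trans (by linarith))
      rw [map_sub, ← dist_eq_norm] at h1
      have h2 : dist (φ (f * x i)) (φ (f * d)) < ε / 4 := hi
      have h3 := dist_triangle (φ (x i)) (φ (f * x i)) (φ (f * d))
      change dist (φ (x i)) (φ (f * d)) < ε / 2
      linarith
    · have := dist_triangle_right y z (φ (f * d))
      rw [Metric.mem_ball] at hy hz
      linarith
  exact CompleteSpace.complete hc

/-- Two bounded families in `I` converging strictly to the same element have the same limit
under `φ`. -/
theorem exists_tendsto_apply_and_tendsto_apply {C : ℝ} (hC : ∀ x ∈ I, ‖φ x‖ ≤ C * ‖x‖)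
    (hl : ∀ b x : B, x ∈ I → b * x ∈ I) (hr : ∀ b x : B, x ∈ I → x * b ∈ I)
    (happrox : ∀ ε : ℝ, 0 < ε → ∃ f ∈ I, ∀ x ∈ I, ‖φ (x - f * x)‖ ≤ ε * ‖x‖)
    {ι κ : Type*} {L : Filter ι} {L' : Filter κ} [L.NeBot] {x : ι → B} {y : κ → B}
    (hx : ∀ i, x i ∈ I) (hy : ∀ j, y j ∈ I) {K : ℝ}
    (hxK : ∀ i, ‖x i‖ ≤ K) (hyK : ∀ j, ‖y j‖ ≤ K) {d : B}
    (hxlim : ∀ f ∈ I, Tendsto (fun i => f * x i) L (nhds (f * d)))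
    (hylim : ∀ f ∈ I, Tendsto (fun j => f * y j) L' (nhds (f * d))) :
    ∃ a, Tendsto (fun i => φ (x i)) L (nhds a) ∧ Tendsto (fun j => φ (y j)) L' (nhds a) := by
  have : (map Sum.inl L ⊔ map Sum.inr L' : Filter (ι ⊕ κ)).NeBot :=
    NeBot.mono (inferInstanceAs (map Sum.inl L).NeBot) le_sup_left
  obtain ⟨a, ha⟩ := exists_tendsto_apply hC hl hr happrox
    (L := map Sum.inl L ⊔ map Sum.inr L') (x := Sum.elim x y) (K := K) (d := d)
    (by rintro (i | j); exacts [hx i, hy j])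
    (by rintro (i | j); exacts [hxK i, hyK j])
    (fun f hf => tendsto_sup.2
      ⟨tendsto_map'_iff.2 (hxlim f hf), tendsto_map'_iff.2 (hylim f hf)⟩)
  rw [tendsto_sup] at ha
  exact ⟨a, tendsto_map'_iff.1 ha.1, tendsto_map'_iff.1 ha.2⟩

theorem star_mem_of_tendsto_mul
    (hr : ∀ b x : B, x ∈ I → x * b ∈ I) (hclosed : IsClosed (I : Set B))
    {ι : Type*} {L : Filter ι} [L.NeBot] {e : ι → B} (he : ∀ i, e i ∈ I)
    (he_star : ∀ i, star (e i) = e i)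
    (he_right : ∀ x ∈ I, Tendsto (fun i => x * e i) L (nhds x)) {x : B} (hx : x ∈ I) :
    star x ∈ I := by
  refine hclosed.mem_of_tendsto ((continuous_star.tendsto _).comp (he_right x hx))
    (Eventually.of_forall fun i => ?_)
  simpa [he_star] using hr (star x) _ (he i)

theorem tendsto_mul_left_of_tendsto_mul_right (hstar : ∀ x ∈ I, star x ∈ I)
    {ι : Type*} {L : Filter ι} {e : ι → B} (he_star : ∀ i, star (e i) = e i)
    (he_right : ∀ x ∈ I, Tendsto (fun i => x * e i) L (nhds x)) {x : B} (hx : x ∈ I) :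
    Tendsto (fun i => e i * x) L (nhds x) := by
  simpa [Function.comp_def, he_star] using
    (continuous_star.tendsto _).comp (he_right _ (hstar x hx))

/-- A bounded tracial functional on `I` also satisfies the trace identity against elements of
the ambient algebra. -/
theorem apply_mul_comm_of_mem {C : ℝ} (hC : ∀ x ∈ I, ‖φ x‖ ≤ C * ‖x‖)
    (hl : ∀ b x : B, x ∈ I → b * x ∈ I) (hr : ∀ b x : B, x ∈ I → x * b ∈ I)
    (htr : ∀ x ∈ I, ∀ y ∈ I, φ (x * y) = φ (y * x))
    {ι : Type*} {L : Filter ι} [L.NeBot] {e : ι → B} (he : ∀ i, e i ∈ I)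
    (he_left : ∀ x ∈ I, Tendsto (fun i => e i * x) L (nhds x))
    (he_right : ∀ x ∈ I, Tendsto (fun i => x * e i) L (nhds x)) (b : B) {x : B}
    (hx : x ∈ I) : φ (b * x) = φ (x * b) := by
  have h1 : Tendsto (fun i => φ (e i * (b * x))) L (nhds (φ (b * x))) :=
    tendsto_apply_of_mem hC (fun i => hl _ _ (hl _ _ hx)) (hl _ _ hx) (he_left _ (hl _ _ hx))
  have h2 : Tendsto (fun i => φ ((x * e i) * b)) L (nhds (φ (x * b))) :=
    tendsto_apply_of_mem hC (fun i => hr _ _ (hl _ _ (he i))) (hr _ _ hx)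
      ((he_right _ hx).mul_const b)
  refine tendsto_nhds_unique h1 (h2.congr fun i => ?_)
  rw [mul_assoc, htr x hx _ (hr _ _ (he i)), mul_assoc]

end IdealFunctional

/-- Let `B` be a C*-algebra, `I` a closed two-sided ideal of `B`, and `ψ` a
bounded positive tracial linear functional on `I`.  For any approximate unit `(e l)` of `I`,
the net `(ψ (b * e l))` converges for every `b ∈ B`; the resulting functional
`ψ̄ b = lim_l ψ (b * e l)` is a bounded positive linear functional on `B` extending `ψ`,
independent of the chosen approximate unit (here witnessed by a second approximate unit
`e'`), and `ψ̄` is tracial. -/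
theorem stmt4 {B : Type*} [NonUnitalCStarAlgebra B] [PartialOrder B] [StarOrderedRing B]
    (I : Submodule ℂ B)
    (hIl : ∀ b x : B, x ∈ I → b * x ∈ I)
    (hIr : ∀ b x : B, x ∈ I → x * b ∈ I)
    (hIclosed : IsClosed (I : Set B))
    (ψ : I →ₗ[ℂ] ℂ)
    (hψ_bdd : ∃ C : ℝ, ∀ x : I, ‖ψ x‖ ≤ C * ‖(x : B)‖)
    (hψ_pos : ∀ x : I, 0 ≤ (x : B) → 0 ≤ ψ x)
    (hψ_tr : ∀ x y : I,
      ψ ⟨(x : B) * (y : B), hIl (x : B) (y : B) y.2⟩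
        = ψ ⟨(y : B) * (x : B), hIl (y : B) (x : B) x.2⟩)
    -- a first approximate unit of `I`
    {Λ : Type*} [Preorder Λ] [IsDirected Λ (· ≤ ·)] [Nonempty Λ]
    (e : Λ → I)
    (he_pos : ∀ l, 0 ≤ (e l : B)) (he_norm : ∀ l, ‖(e l : B)‖ ≤ 1)
    (he_lim : ∀ x : I, Tendsto (fun l => ‖(x : B) - (x : B) * (e l : B)‖) atTop (nhds 0))
    -- a second approximate unit of `I`
    {Λ' : Type*} [Preorder Λ'] [IsDirected Λ' (· ≤ ·)] [Nonempty Λ']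
    (e' : Λ' → I)
    (he'_pos : ∀ l, 0 ≤ (e' l : B)) (he'_norm : ∀ l, ‖(e' l : B)‖ ≤ 1)
    (he'_lim : ∀ x : I, Tendsto (fun l => ‖(x : B) - (x : B) * (e' l : B)‖) atTop (nhds 0)) :
    ∃ ψbar : B →ₗ[ℂ] ℂ,
      (∀ b : B, Tendsto (fun l => ψ ⟨b * (e l : B), hIl b (e l : B) (e l).2⟩)
        atTop (nhds (ψbar b))) ∧
      (∀ b : B, Tendsto (fun l => ψ ⟨b * (e' l : B), hIl b (e' l : B) (e' l).2⟩)
        atTop (nhds (ψbar b))) ∧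
      (∃ C : ℝ, ∀ b : B, ‖ψbar b‖ ≤ C * ‖b‖) ∧
      (∀ b : B, 0 ≤ b → 0 ≤ ψbar b) ∧
      (∀ x : I, ψbar (x : B) = ψ x) ∧
      (∀ b c : B, ψbar (b * c) = ψbar (c * b)) := by
  obtain ⟨φ, hφ⟩ := LinearMap.exists_extend ψ
  have hψφ : ∀ x : I, ψ x = φ x := fun x => by rw [← hφ]; rfl
  simp only [hψφ] at hψ_bdd hψ_pos hψ_tr ⊢
  obtain ⟨C₀, hC₀⟩ := hψ_bdd
  obtain ⟨C, hC0, hC⟩ : ∃ C : ℝ, 0 ≤ C ∧ ∀ x ∈ I, ‖φ x‖ ≤ C * ‖x‖ :=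
    ⟨|C₀|, abs_nonneg _, fun x hx =>
      (hC₀ ⟨x, hx⟩).trans (mul_le_mul_of_nonneg_right (le_abs_self _) (norm_nonneg _))⟩
  have he_star : ∀ l, star (e l : B) = e l := fun l => (IsSelfAdjoint.of_nonneg (he_pos l)).star_eq
  have he_right : ∀ x ∈ I, Tendsto (fun l => x * (e l : B)) atTop (nhds x) := fun x hx => by
    rw [tendsto_iff_norm_sub_tendsto_zero]
    simpa only [norm_sub_rev] using he_lim ⟨x, hx⟩
  have he'_right : ∀ x ∈ I, Tendsto (fun l => x * (e' l : B)) atTop (nhds x) := fun x hx => by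
    rw [tendsto_iff_norm_sub_tendsto_zero]
    simpa only [norm_sub_rev] using he'_lim ⟨x, hx⟩
  have heI : ∀ l, (e l : B) ∈ I := fun l => (e l).2
  have hstar : ∀ x ∈ I, star x ∈ I := fun x hx =>
    star_mem_of_tendsto_mul hIr hIclosed heI he_star he_right hx
  have he_left : ∀ x ∈ I, Tendsto (fun l => (e l : B) * x) atTop (nhds x) := fun x hx =>
    tendsto_mul_left_of_tendsto_mul_right hstar he_star he_right hx
  have hpos : ∀ x ∈ I, 0 ≤ φ (star x * x) := fun x hx =>
    hψ_pos ⟨_, hIl _ _ hx⟩ (star_mul_self_nonneg x)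
  have htr : ∀ (b : B) {x : B}, x ∈ I → φ (b * x) = φ (x * b) := fun b x hx =>
    apply_mul_comm_of_mem hC hIl hIr (fun x hx y hy => hψ_tr ⟨x, hx⟩ ⟨y, hy⟩) heI he_left
      he_right b hx
  have happrox : ∀ ε : ℝ, 0 < ε → ∃ f ∈ I, ∀ x ∈ I, ‖φ (x - f * x)‖ ≤ ε * ‖x‖ := fun ε hε =>
    exists_norm_apply_sub_mul_le hC0 hC hIl hpos heI he_star he_norm he_left he_right hε
  have norm_mul_le : ∀ b u : B, ‖u‖ ≤ 1 → ‖b * u‖ ≤ ‖b‖ := fun b u hu =>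
    (_root_.norm_mul_le b u).trans (mul_le_of_le_one_right (norm_nonneg _) hu)
  have hlim : ∀ b : B, ∃ a, Tendsto (fun l => φ (b * (e l : B))) atTop (nhds a) ∧
      Tendsto (fun l => φ (b * (e' l : B))) atTop (nhds a) := fun b =>
    exists_tendsto_apply_and_tendsto_apply hC hIl hIr happrox (K := ‖b‖) (d := b)
      (fun l => hIl _ _ (e l).2) (fun l => hIl _ _ (e' l).2)
      (fun l => norm_mul_le _ _ (he_norm l)) (fun l => norm_mul_le _ _ (he'_norm l))
      (fun f hf => by simpa only [mul_assoc] using he_right _ (hIr b f hf))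
      (fun f hf => by simpa only [mul_assoc] using he'_right _ (hIr b f hf))
  choose θ hθ hθ' using hlim
  refine ⟨⟨⟨θ, fun b c => ?_⟩, fun r b => ?_⟩, hθ, hθ', ⟨C, fun b => ?_⟩, fun b hb => ?_,
    fun x => ?_, fun b c => ?_⟩
  · refine tendsto_nhds_unique (hθ (b + c)) ?_
    simpa only [add_mul, map_add] using (hθ b).add (hθ c)
  · refine tendsto_nhds_unique (hθ (r • b)) ?_
    simpa only [smul_mul_assoc, map_smul, RingHom.id_apply] using (hθ b).const_smul r
  · refine le_of_tendsto (hθ b).norm (Eventually.of_forall fun l => ?_)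
    exact (hC _ (hIl _ _ (e l).2)).trans
      (mul_le_mul_of_nonneg_left (norm_mul_le _ _ (he_norm l)) hC0)
  · refine ge_of_tendsto (hθ b) (Eventually.of_forall fun l => ?_)
    obtain ⟨c, rfl⟩ := CStarAlgebra.nonneg_iff_eq_star_mul_self.1 hb
    rw [mul_assoc, htr _ (hIl c _ (e l).2)]
    exact hψ_pos ⟨_, hIr _ _ (hIl c _ (e l).2)⟩ (star_right_conjugate_nonneg (he_pos l) c)
  · exact tendsto_nhds_unique (hθ x) (tendsto_apply_of_mem hC (fun l => hIl _ _ (e l).2) x.2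
      (he_right x x.2))
  · obtain ⟨a, ha, ha'⟩ := exists_tendsto_apply_and_tendsto_apply hC hIl hIr happrox
      (L := atTop) (L' := atTop) (x := fun l => c * b * (e l : B)) (y := fun l => c * (e l : B) * b)
      (K := ‖c‖ * ‖b‖) (d := c * b)
      (fun l => hIl _ _ (e l).2) (fun l => hIr _ _ (hIl _ _ (e l).2))
      (fun l => (norm_mul_le _ _ (he_norm l)).trans (_root_.norm_mul_le c b))
      (fun l => (_root_.norm_mul_le _ _).trans
        (mul_le_mul_of_nonneg_right (norm_mul_le _ _ (he_norm l)) (norm_nonneg _)))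
      (fun f hf => by simpa only [mul_assoc] using he_right _ (hIr (c * b) f hf))
      (fun f hf => by simpa only [mul_assoc] using (he_right _ (hIr c f hf)).mul_const b)
    have h1 : θ (c * b) = a := tendsto_nhds_unique (hθ _) ha
    have h2 : θ (b * c) = a := tendsto_nhds_unique (hθ _) (ha'.congr fun l => by
      rw [← htr b (hIl c _ (e l).2), mul_assoc])
    exact h2.trans h1.symm
end

section
/- Let B be a unital C*-algebra, A a C*-subalgebra of B containing the unit of B, and I a closed two-sided ideal of B such that B = A + I. Let φ be a tracial state on A and ψ a bounded positive tracial linear functional on I. Assume that φ(x) = ψ(x) for all x ∈ A ∩ I, and that the canonical extension ψ̄ of ψ to B satisfies ψ̄(x) ≤ φ(x) for all positive x ∈ A. Then there exists a unique tracial state Φ on B such that Φ restricted to A equals φ and Φ restricted to I equals ψ. -/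
open scoped ComplexOrder
open Filter

section ApproximateUnit

variable {B Λ : Type*} [CStarAlgebra B]
  [Preorder Λ] [IsDirected Λ (· ≤ ·)] [Nonempty Λ] {I : Submodule ℂ B} {e : Λ → I}

/-- A bounded tracial functional on an ideal with an approximate unit is invariant under
commuting elements of the ideal with arbitrary elements. -/
theorem tracial_ideal_apply_mul_comm (hIl : ∀ b x : B, x ∈ I → b * x ∈ I)
    (hIr : ∀ b x : B, x ∈ I → x * b ∈ I)
    (he : ∀ x ∈ I, Tendsto (fun l => x * (e l : B)) atTop (nhds x))
    (ψ : I →ₗ[ℂ] ℂ) (hψ_cont : Continuous ψ)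
    (hψ_tr : ∀ x y : I, ψ ⟨(x : B) * (y : B), hIl (x : B) (y : B) y.2⟩
      = ψ ⟨(y : B) * (x : B), hIl (y : B) (x : B) x.2⟩)
    (b : B) (x : I) : ψ ⟨b * x, hIl b x x.2⟩ = ψ ⟨x * b, hIr b x x.2⟩ := by
  have h1 : Tendsto (fun l => ψ ⟨b * x * (e l : B), hIl _ _ (e l).2⟩) atTop
      (nhds (ψ ⟨b * x, hIl b x x.2⟩)) :=
    (hψ_cont.tendsto _).comp (tendsto_subtype_rng.mpr (he _ (hIl b x x.2)))
  have h2 : Tendsto (fun l => ψ ⟨x * (e l : B) * b, hIr _ _ (hIl _ _ (e l).2)⟩) atTop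
      (nhds (ψ ⟨x * b, hIr b x x.2⟩)) :=
    (hψ_cont.tendsto _).comp (tendsto_subtype_rng.mpr ((he _ x.2).mul_const b))
  refine tendsto_nhds_unique h1 (h2.congr fun l => ?_)
  calc ψ ⟨x * (e l : B) * b, _⟩ = ψ ⟨x * (e l * b), hIl _ _ (hIr _ _ (e l).2)⟩ := by
        simp only [mul_assoc]
    _ = ψ ⟨e l * b * x, hIl _ _ x.2⟩ := hψ_tr x ⟨e l * b, hIr _ _ (e l).2⟩
    _ = ψ ⟨e l * (b * x), hIl _ _ (hIl _ _ x.2)⟩ := by simp only [mul_assoc]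
    _ = _ := hψ_tr (e l) ⟨b * x, hIl _ _ x.2⟩

variable [PartialOrder B] [StarOrderedRing B]

/-- A closed left ideal with a bounded right approximate unit contains every `z` such that
`star z * z` is dominated by an element of the ideal. -/
theorem mem_of_star_mul_self_le (hIl : ∀ b x : B, x ∈ I → b * x ∈ I)
    (hIclosed : IsClosed (I : Set B)) (he_norm : ∀ l, ‖(e l : B)‖ ≤ 1)
    (he : ∀ x ∈ I, Tendsto (fun l => x * (e l : B)) atTop (nhds x))
    {y z : B} (hy : y ∈ I) (hzy : star z * z ≤ y) : z ∈ I := by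
  refine hIclosed.mem_of_tendsto (f := fun l => z * (e l : B)) (b := atTop) ?_
    (Eventually.of_forall fun l => hIl _ _ (e l).2)
  rw [tendsto_iff_norm_sub_tendsto_zero]
  have hbound : ∀ l, ‖z * (e l : B) - z‖ ^ 2 ≤ (‖(1 : B)‖ + 1) * ‖y * (e l : B) - y‖ := by
    intro l
    set d : B := (e l : B) - 1 with hd
    have h1 : z * (e l : B) - z = z * d := by rw [hd]; noncomm_ring
    have h2 : y * (e l : B) - y = y * d := by rw [hd]; noncomm_ring
    have hdn : ‖star d‖ ≤ ‖(1 : B)‖ + 1 := by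
      rw [norm_star, add_comm]
      exact (norm_sub_le _ _).trans (by gcongr; exact he_norm l)
    have h3 : star (z * d) * (z * d) ≤ star d * y * d := by
      have := star_left_conjugate_le_conjugate hzy d
      simpa [mul_assoc] using this
    calc ‖z * (e l : B) - z‖ ^ 2 = ‖star (z * d) * (z * d)‖ := by
          rw [h1, CStarRing.norm_star_mul_self, sq]
      _ ≤ ‖star d * y * d‖ :=
          CStarAlgebra.norm_le_norm_of_nonneg_of_le (star_mul_self_nonneg _) h3
      _ ≤ ‖star d‖ * ‖y * d‖ := by rw [mul_assoc]; exact norm_mul_le _ _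
      _ ≤ _ := by rw [h2]; gcongr
  have hlim : Tendsto (fun l => (‖(1 : B)‖ + 1) * ‖y * (e l : B) - y‖) atTop (nhds 0) := by
    simpa using (tendsto_iff_norm_sub_tendsto_zero.mp (he y hy)).const_mul (‖(1 : B)‖ + 1)
  have hsq := squeeze_zero (fun l => sq_nonneg _) hbound hlim
  simpa [Real.sqrt_sq] using hsq.sqrt

/-- A closed two-sided ideal with a self-adjoint right approximate unit is self-adjoint. -/
theorem star_mem_of_approximateUnit (hIr : ∀ b x : B, x ∈ I → x * b ∈ I)
    (hIclosed : IsClosed (I : Set B)) (he_pos : ∀ l, 0 ≤ (e l : B))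
    (he : ∀ x ∈ I, Tendsto (fun l => x * (e l : B)) atTop (nhds x))
    {x : B} (hx : x ∈ I) : star x ∈ I := by
  refine hIclosed.mem_of_tendsto (he x hx).star (Eventually.of_forall fun l => ?_)
  rw [star_mul, (IsSelfAdjoint.of_nonneg (he_pos l)).star_eq]
  exact hIr _ _ (e l).2

/-- If a self-adjoint `a` is positive modulo a closed two-sided ideal, then its negative part lies
in the ideal. -/
theorem negPart_mem_of_add_nonneg (hIl : ∀ b x : B, x ∈ I → b * x ∈ I)
    (hIr : ∀ b x : B, x ∈ I → x * b ∈ I)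
    (hIclosed : IsClosed (I : Set B)) (he_norm : ∀ l, ‖(e l : B)‖ ≤ 1)
    (he : ∀ x ∈ I, Tendsto (fun l => x * (e l : B)) atTop (nhds x))
    {a x : B} (ha : IsSelfAdjoint a) (hx : x ∈ I) (hax : 0 ≤ a + x) : a⁻ ∈ I := by
  have hn : 0 ≤ a⁻ := CFC.negPart_nonneg a
  have hns : star a⁻ = a⁻ := (IsSelfAdjoint.of_nonneg hn).star_eq
  have hmem : ∀ {y z : B}, y ∈ I → star z * z ≤ y → z ∈ I := fun hy hzy =>
    mem_of_star_mul_self_le hIl hIclosed he_norm he hy hzy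
  have hcube : 0 ≤ a⁻ * a⁻ * a⁻ := by
    have := star_left_conjugate_nonneg hn a⁻
    rwa [hns] at this
  have haa : a⁻ * a * a⁻ = -(a⁻ * a⁻ * a⁻) := by
    calc a⁻ * a * a⁻ = a⁻ * (a⁺ - a⁻) * a⁻ := by rw [CFC.posPart_sub_negPart a ha]
      _ = _ := by simp [mul_sub]
  have hle : a⁻ * a⁻ * a⁻ ≤ a⁻ * x * a⁻ := by
    have := star_left_conjugate_nonneg hax a⁻
    rwa [hns, mul_add, add_mul, haa, neg_add_eq_sub, sub_nonneg] at this
  have hsqrt : CFC.sqrt (a⁻ * a⁻ * a⁻) * CFC.sqrt (a⁻ * a⁻ * a⁻) = a⁻ * a⁻ * a⁻ :=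
    CFC.sqrt_mul_sqrt_self _ hcube
  have hs : CFC.sqrt (a⁻ * a⁻ * a⁻) ∈ I := by
    refine hmem (hIr a⁻ _ (hIl a⁻ _ hx)) ?_
    rw [(IsSelfAdjoint.of_nonneg (CFC.sqrt_nonneg _)).star_eq, hsqrt]
    exact hle
  have h3 : a⁻ * a⁻ * a⁻ ∈ I := hsqrt ▸ hIl _ _ hs
  have h2 : a⁻ * a⁻ ∈ I := by
    refine hmem (hIl a⁻ _ h3) (le_of_eq ?_)
    rw [star_mul, hns]; noncomm_ring
  exact hmem h2 (le_of_eq (by rw [hns]))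

end ApproximateUnit

/-- Linear functionals on two submodules that span the whole space and that agree on the
intersection glue to a linear functional on the whole space. -/
theorem exists_linearMap_add_eq {B : Type*} [AddCommGroup B] [Module ℂ B] (A I : Submodule ℂ B)
    (hsum : ∀ b : B, ∃ a ∈ A, ∃ x ∈ I, b = a + x) (φ : A →ₗ[ℂ] ℂ) (ψ : I →ₗ[ℂ] ℂ)
    (hcompat : ∀ (x : B) (hxA : x ∈ A) (hxI : x ∈ I), φ ⟨x, hxA⟩ = ψ ⟨x, hxI⟩) :
    ∃ Φ : B →ₗ[ℂ] ℂ, (∀ a : A, Φ a = φ a) ∧ (∀ x : I, Φ x = ψ x) := by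
  choose a ha x hx hax using hsum
  have key : ∀ (b : B) (a' : A) (x' : I), b = a' + x' →
      φ ⟨a b, ha b⟩ + ψ ⟨x b, hx b⟩ = φ a' + ψ x' := by
    intro b a' x' h
    have hd : (a' : B) - a b = x b - x' := by
      rw [sub_eq_sub_iff_add_eq_add, ← h, add_comm, ← hax]
    have hA : (a' : B) - a b ∈ A := A.sub_mem a'.2 (ha b)
    have hI : (a' : B) - a b ∈ I := hd ▸ I.sub_mem (hx b) x'.2
    have h1 : φ ⟨(a' : B) - a b, hA⟩ = φ a' - φ ⟨a b, ha b⟩ := map_sub φ a' ⟨a b, ha b⟩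
    have h2 : ψ ⟨(a' : B) - a b, hI⟩ = ψ ⟨x b, hx b⟩ - ψ x' := by
      rw [← map_sub]; congr 1; exact Subtype.ext hd
    have h3 := hcompat _ hA hI
    rw [h1, h2] at h3
    linear_combination -h3
  refine ⟨{ toFun := fun b => φ ⟨a b, ha b⟩ + ψ ⟨x b, hx b⟩
            map_add' := fun b c => ?_
            map_smul' := fun r b => ?_ }, fun a' => ?_, fun x' => ?_⟩
  · rw [key (b + c) (⟨a b, ha b⟩ + ⟨a c, ha c⟩) (⟨x b, hx b⟩ + ⟨x c, hx c⟩), map_add, map_add]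
    · ring
    · conv_lhs => rw [hax b, hax c]
      exact add_add_add_comm _ _ _ _
  · rw [key (r • b) (r • ⟨a b, ha b⟩) (r • ⟨x b, hx b⟩), map_smul, map_smul, ← smul_add]
    · rfl
    · conv_lhs => rw [hax b]
      exact smul_add _ _ _
  · simpa using key a' a' 0 (by simp)
  · simpa using key x' 0 x' (by simp)

/-- Let `B` be a unital C*-algebra, `A` a C*-subalgebra containing the unit,
`I` a closed two-sided ideal with `B = A + I`.  Let `φ` be a tracial state on `A` and `ψ` a
bounded positive tracial functional on `I` with `φ = ψ` on `A ∩ I` and whose canonical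
extension `ψ̄` (defined via an approximate unit of `I`) satisfies `ψ̄ ≤ φ` on positive
elements of `A`.  Then there is a unique tracial state `Φ` on `B` with `Φ|_A = φ` and
`Φ|_I = ψ`. -/
theorem stmt5 {B : Type*} [CStarAlgebra B] [PartialOrder B] [StarOrderedRing B]
    (A : StarSubalgebra ℂ B) (hAclosed : IsClosed (A : Set B))
    (I : Submodule ℂ B)
    (hIl : ∀ b x : B, x ∈ I → b * x ∈ I)
    (hIr : ∀ b x : B, x ∈ I → x * b ∈ I)
    (hIclosed : IsClosed (I : Set B))
    -- `B = A + I`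
    (hsum : ∀ b : B, ∃ a ∈ A, ∃ x ∈ I, b = a + x)
    -- `φ` is a tracial state on `A`
    (φ : A →ₗ[ℂ] ℂ)
    (hφ_pos : ∀ x : A, 0 ≤ (x : B) → 0 ≤ φ x)
    (hφ_one : φ 1 = 1)
    (hφ_tr : ∀ x y : A, φ (x * y) = φ (y * x))
    -- `ψ` is a bounded positive tracial linear functional on `I`
    (ψ : I →ₗ[ℂ] ℂ)
    (hψ_bdd : ∃ C : ℝ, ∀ x : I, ‖ψ x‖ ≤ C * ‖(x : B)‖)
    (hψ_pos : ∀ x : I, 0 ≤ (x : B) → 0 ≤ ψ x)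
    (hψ_tr : ∀ x y : I,
      ψ ⟨(x : B) * (y : B), hIl (x : B) (y : B) y.2⟩
        = ψ ⟨(y : B) * (x : B), hIl (y : B) (x : B) x.2⟩)
    -- `φ` and `ψ` agree on `A ∩ I`
    (hcompat : ∀ (x : B) (hxA : x ∈ A) (hxI : x ∈ I), φ ⟨x, hxA⟩ = ψ ⟨x, hxI⟩)
    -- `ψbar` is the canonical extension of `ψ` to `B`, via an approximate unit `e` of `I`
    {Λ : Type*} [Preorder Λ] [IsDirected Λ (· ≤ ·)] [Nonempty Λ]
    (e : Λ → I)
    (he_pos : ∀ l, 0 ≤ (e l : B)) (he_norm : ∀ l, ‖(e l : B)‖ ≤ 1)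
    (he_lim : ∀ x : I, Tendsto (fun l => ‖(x : B) - (x : B) * (e l : B)‖) atTop (nhds 0))
    (ψbar : B →ₗ[ℂ] ℂ)
    (hψbar : ∀ b : B, Tendsto (fun l => ψ ⟨b * (e l : B), hIl b (e l : B) (e l).2⟩)
      atTop (nhds (ψbar b)))
    -- the canonical extension is dominated by `φ` on positive elements of `A`
    (hdom : ∀ x : A, 0 ≤ (x : B) → ψbar (x : B) ≤ φ x) :
    ∃! Φ : B →ₗ[ℂ] ℂ,
      (∀ b : B, 0 ≤ b → 0 ≤ Φ b) ∧ Φ 1 = 1 ∧ (∀ b c : B, Φ (b * c) = Φ (c * b)) ∧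
      (∀ x : A, Φ (x : B) = φ x) ∧ (∀ x : I, Φ (x : B) = ψ x) := by
  have he : ∀ x ∈ I, Tendsto (fun l => x * (e l : B)) atTop (nhds x) := fun x hx => by
    rw [tendsto_iff_norm_sub_tendsto_zero]
    simpa only [norm_sub_rev] using he_lim ⟨x, hx⟩
  have hψ_cont : Continuous ψ := by
    obtain ⟨C, hC⟩ := hψ_bdd
    exact (ψ.mkContinuous C hC).continuous
  have hψ_comm := tracial_ideal_apply_mul_comm hIl hIr he ψ hψ_cont hψ_tr
  have hψbar_ideal : ∀ x : I, ψbar x = ψ x := fun x =>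
    tendsto_nhds_unique (hψbar x)
      ((hψ_cont.tendsto _).comp (tendsto_subtype_rng.mpr (he _ x.2)))
  have hψbar_pos : ∀ b : B, 0 ≤ b → 0 ≤ ψbar b := by
    intro b hb
    refine ge_of_tendsto' (hψbar b) fun l => ?_
    set s := CFC.sqrt b
    have hs : star s = s := (IsSelfAdjoint.of_nonneg (CFC.sqrt_nonneg b)).star_eq
    have h : ψ ⟨b * e l, hIl _ _ (e l).2⟩ = ψ ⟨s * e l * s, hIr _ _ (hIl _ _ (e l).2)⟩ := by
      rw [← hψ_comm s ⟨s * e l, hIl _ _ (e l).2⟩]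
      simp only [← mul_assoc, s, CFC.sqrt_mul_sqrt_self b hb]
    rw [h]
    refine hψ_pos _ ?_
    have := star_left_conjugate_nonneg (he_pos l) s
    rwa [hs] at this
  obtain ⟨Φ, hΦA, hΦI⟩ := exists_linearMap_add_eq (Subalgebra.toSubmodule A.toSubalgebra) I hsum
    φ ψ hcompat
  replace hΦA : ∀ x : A, Φ x = φ x := hΦA
  refine ⟨Φ, ⟨?_, ?_, ?_, hΦA, hΦI⟩, ?_⟩
  · have hneg : ∀ (a : A) (x : I), IsSelfAdjoint (a : B) → 0 ≤ (a : B) + x →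
        0 ≤ Φ ((a : B) + x) := by
      intro a x ha hax
      have hpA : (a : B)⁺ ∈ A := cfcₙ_mem (hs := hAclosed) (𝕜' := ℂ) _ a.2
      have hnA : (a : B)⁻ ∈ A := cfcₙ_mem (hs := hAclosed) (𝕜' := ℂ) _ a.2
      have hnI : (a : B)⁻ ∈ I := negPart_mem_of_add_nonneg hIl hIr hIclosed he_norm he ha x.2 hax
      have hpos : 0 ≤ Φ (a : B)⁺ - ψbar (a : B)⁺ := by
        rw [sub_nonneg, hΦA ⟨_, hpA⟩]
        exact hdom ⟨_, hpA⟩ (CFC.posPart_nonneg _)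
      have hn : Φ (a : B)⁻ = ψbar (a : B)⁻ := by
        rw [hΦI ⟨_, hnI⟩, hψbar_ideal ⟨_, hnI⟩]
      have hx : Φ (x : B) = ψbar x := by rw [hΦI, hψbar_ideal]
      have hsplit : Φ ((a : B) + x) =
          (Φ (a : B)⁺ - ψbar (a : B)⁺) + ψbar ((a : B) + x) := by
        have hΦa := congrArg Φ (CFC.posPart_sub_negPart (a : B) ha)
        have hψa := congrArg ψbar (CFC.posPart_sub_negPart (a : B) ha)
        rw [map_sub] at hΦa hψa
        rw [map_add, map_add]
        linear_combination hx - hn - hΦa + hψa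
      rw [hsplit]
      exact add_nonneg hpos (hψbar_pos _ hax)
    intro b hb
    obtain ⟨a, ha, x, hx, rfl⟩ := hsum b
    have hsa := (IsSelfAdjoint.of_nonneg hb).star_eq
    have hre : a + x = (2⁻¹ : ℂ) • (a + star a) + (2⁻¹ : ℂ) • (x + star x) := by
      rw [← smul_add, add_add_add_comm, ← star_add, hsa, ← two_smul ℂ, smul_smul]
      norm_num
    rw [hre]
    refine hneg ⟨_, A.smul_mem (add_mem ha (star_mem ha)) _⟩
      ⟨_, I.smul_mem _ (add_mem hx (star_mem_of_approximateUnit hIr hIclosed he_pos he hx))⟩ ?_ ?_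
    · simp [IsSelfAdjoint, add_comm]
    · rwa [← hre]
  · exact (hΦA 1).trans hφ_one
  · intro b c
    have hmix : ∀ (b : B) (x : I), Φ (b * x) = Φ (x * b) := fun b x => by
      rw [hΦI ⟨b * x, hIl _ _ x.2⟩, hΦI ⟨x * b, hIr _ _ x.2⟩, hψ_comm]
    obtain ⟨a, ha, x, hx, rfl⟩ := hsum b
    obtain ⟨a', ha', x', hx', rfl⟩ := hsum c
    have hAA : Φ (a * a') = Φ (a' * a) :=
      (hΦA (⟨a, ha⟩ * ⟨a', ha'⟩)).trans ((hφ_tr _ _).trans (hΦA (⟨a', ha'⟩ * ⟨a, ha⟩)).symm)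
    simp only [add_mul, mul_add, map_add]
    linear_combination hAA + hmix a ⟨x', hx'⟩ - hmix a' ⟨x, hx⟩ + hmix x ⟨x', hx'⟩
  · rintro Ψ ⟨-, -, -, hΨA, hΨI⟩
    ext b
    obtain ⟨a, ha, x, hx, rfl⟩ := hsum b
    rw [map_add, map_add, hΨA ⟨a, ha⟩, hΨI ⟨x, hx⟩, hΦA ⟨a, ha⟩, hΦI ⟨x, hx⟩]
end

section
/- Let E = (E⁰, E¹) be a finite directed graph without multiple edges. Define A = C(E⁰) and X = C(E¹) (complex-valued functions), with A-valued inner product (ξ|η)_A(v) = Σ_{e ∈ E¹, r(e)=v} conj(ξ(e))·η(e), and left action (φ(f)ξ)(e) = f(s(e))·ξ(e) for f ∈ A, ξ, η ∈ X. For each edge e let χ_e ∈ X be its characteristic function. Then for every linear functional τ on C(E⁰), identified with the vector (τ_v)_{v∈E⁰} where τ_v = τ(χ_v), and every f ∈ C(E⁰): Σ_{e ∈ E¹} τ((χ_e | φ(f) χ_e)_A) = Σ_{v ∈ E⁰} (Bτ)(v)·f(v), where B = Dᵀ is the transpose of the adjacency matrix of E. Consequently, a state τ on C(E⁰) satisfies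 Σ_{e∈E¹} τ((χ_e|φ(f)χ_e)_A) = e^β τ(f) for all f vanishing on sinks, and Σ_{e∈E¹} τ((χ_e|φ(f)χ_e)_A) ≤ e^β τ(f) for all f ≥ 0, if and only if the vector (τ_v) satisfies (Bτ)(w) = e^β τ(w) for every non-sink vertex w and (Bτ)(v) ≤ e^β τ(v) for every vertex v. -/
open scoped ComplexOrder

/-- A vertex `v` is a sink if no edge starts at it. -/
def IsSink {V E : Type*} (s : E → V) (v : V) : Prop := ¬ ∃ e : E, s e = v

/-- The adjacency matrix of the graph with source map `s` and range map `r`: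
`D i j = 1` iff there is an edge from `j` to `i`. -/
def adjMatrix (α : Type*) [Zero α] [One α] {V E : Type*} [Fintype E] [DecidableEq V]
    (s r : E → V) : Matrix V V α :=
  Matrix.of fun i j => if ∃ e : E, s e = j ∧ r e = i then 1 else 0

/-- The `A = C(E⁰)`-valued inner product on `X = C(E¹)`:
`(ξ|η)_A(v) = Σ_{r(e)=v} conj (ξ e) * η e`. -/
noncomputable def graphInner {V E : Type*} [Fintype E] [DecidableEq V] (r : E → V) (ξ η : E → ℂ) :
    V → ℂ :=
  fun v => ∑ e : E, if r e = v then (starRingEnd ℂ) (ξ e) * η e else 0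

/-- The left action `φ` of `A = C(E⁰)` on `X = C(E¹)`: `(φ(f)ξ)(e) = f (s e) * ξ e`. -/
def graphLeftAct {V E : Type*} (s : E → V) (f : V → ℂ) (ξ : E → ℂ) : E → ℂ :=
  fun e => f (s e) * ξ e

theorem graphInner_single_graphLeftAct {V E : Type*} [Fintype E] [DecidableEq V] [DecidableEq E]
    (s r : E → V) (f : V → ℂ) (e : E) :
    graphInner r (Pi.single e 1) (graphLeftAct s f (Pi.single e 1))
      = f (s e) • Pi.single (r e) (1 : ℂ) := by
  funext v
  simp only [graphInner, graphLeftAct]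
  rw [Finset.sum_eq_single e]
  · by_cases h : r e = v
    · subst h; simp
    · simp [h, Ne.symm h]
  · intro b _ hb
    simp [hb]
  · simp

/-- Without multiple edges, the transposed adjacency matrix sums over outgoing edges. -/
theorem adjMatrix_transpose_mulVec {V E : Type*} [Fintype V] [Fintype E] [DecidableEq V]
    (s r : E → V) (hsimple : ∀ e e' : E, s e = s e' → r e = r e' → e = e')
    (t : V → ℂ) (v : V) :
    (adjMatrix ℂ s r).transpose.mulVec t v = ∑ e : E, if s e = v then t (r e) else 0 := by
  classical
  have entry (w : V) : (if ∃ e : E, s e = v ∧ r e = w then (1 : ℂ) else 0)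
      = ∑ e : E, if s e = v ∧ r e = w then 1 else 0 := by
    split_ifs with h
    · obtain ⟨e, rfl, rfl⟩ := h
      rw [Finset.sum_eq_single e]
      · simp
      · intro b _ hb
        exact if_neg fun h => hb (hsimple _ _ h.1 h.2)
      · simp
    · push Not at h
      exact (Finset.sum_eq_zero fun e _ => if_neg fun he => h e he.1 he.2).symm
  simp only [Matrix.mulVec, dotProduct, Matrix.transpose_apply, adjMatrix, Matrix.of_apply, entry,
    Finset.sum_mul]
  rw [Finset.sum_comm]
  refine Finset.sum_congr rfl fun e _ => ?_
  simp [ite_and]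

/-- For a finite graph without multiple edges, with `A = C(E⁰)`,
`X = C(E¹)`, `χ_e = Pi.single e 1` and `B = Dᵀ` the transpose of the adjacency matrix:
for every linear functional `τ` on `C(E⁰)` (identified with the vector `τ_v = τ (χ_v)`) and
every `f ∈ C(E⁰)` one has `Σ_e τ((χ_e | φ(f) χ_e)_A) = Σ_v (Bτ)(v)·f(v)`; consequently, a
state `τ` satisfies the β-conditions iff the vector `(τ_v)` satisfies `(Bτ)(w) = e^β τ(w)`
at every non-sink `w` and `(Bτ)(v) ≤ e^β τ(v)` at every vertex `v`. -/
theorem stmt6 {V E : Type*} [Fintype V] [Fintype E] [DecidableEq V] [DecidableEq E]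
    (s r : E → V)
    (hsimple : ∀ e e' : E, s e = s e' → r e = r e' → e = e')
    (β : ℝ) (hβ : 0 < β)
    (τ : (V → ℂ) →ₗ[ℂ] ℂ)
    (hτ_pos : ∀ f : V → ℂ, 0 ≤ f → 0 ≤ τ f) (hτ_one : τ 1 = 1) :
    (∀ f : V → ℂ,
      ∑ e : E, τ (graphInner r (Pi.single e 1) (graphLeftAct s f (Pi.single e 1)))
        = ∑ v : V,
            ((adjMatrix ℂ s r).transpose.mulVec (fun w => τ (Pi.single w 1))) v * f v)
    ∧
    (((∀ f : V → ℂ, (∀ v : V, IsSink s v → f v = 0) →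
        ∑ e : E, τ (graphInner r (Pi.single e 1) (graphLeftAct s f (Pi.single e 1)))
          = (Real.exp β : ℂ) * τ f) ∧
      (∀ f : V → ℂ, 0 ≤ f →
        ∑ e : E, τ (graphInner r (Pi.single e 1) (graphLeftAct s f (Pi.single e 1)))
          ≤ (Real.exp β : ℂ) * τ f))
      ↔
      ((∀ w : V, ¬ IsSink s w →
          (adjMatrix ℂ s r).transpose.mulVec (fun v => τ (Pi.single v 1)) w
            = (Real.exp β : ℂ) * τ (Pi.single w 1)) ∧
       (∀ v : V,
          (adjMatrix ℂ s r).transpose.mulVec (fun w => τ (Pi.single w 1)) v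
            ≤ (Real.exp β : ℂ) * τ (Pi.single v 1)))) := by
  have trace_eq (f : V → ℂ) :
      ∑ e : E, τ (graphInner r (Pi.single e 1) (graphLeftAct s f (Pi.single e 1)))
        = ∑ v : V,
            ((adjMatrix ℂ s r).transpose.mulVec (fun w => τ (Pi.single w 1))) v * f v := by
    simp only [graphInner_single_graphLeftAct, adjMatrix_transpose_mulVec s r hsimple, map_smul,
      Finset.sum_mul, smul_eq_mul]
    rw [Finset.sum_comm]
    refine Finset.sum_congr rfl fun e _ => ?_
    simp [mul_comm]
  have smul_eq (f : V → ℂ) :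
      (Real.exp β : ℂ) * τ f = ∑ v : V, (Real.exp β : ℂ) * τ (Pi.single v 1) * f v := by
    conv_lhs => rw [pi_eq_sum_univ' f, map_sum, Finset.mul_sum]
    refine Finset.sum_congr rfl fun v _ => ?_
    simp [mul_comm, mul_left_comm]
  refine ⟨trace_eq, ?_⟩
  simp only [trace_eq]
  constructor
  · rintro ⟨heq, hle⟩
    refine ⟨fun w hw => ?_, fun v => ?_⟩
    · have := heq (Pi.single w 1) fun v hv => by
        rw [Pi.single_eq_of_ne]
        rintro rfl
        exact hw hv
      simpa [Pi.single_apply] using this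
    · have := hle (Pi.single v 1) (Pi.single_nonneg.mpr zero_le_one)
      simpa [Pi.single_apply] using this
  · rintro ⟨heq, hle⟩
    refine ⟨fun f hf => ?_, fun f hf => ?_⟩
    · rw [smul_eq]
      refine Finset.sum_congr rfl fun v _ => ?_
      by_cases hv : IsSink s v
      · simp [hf v hv]
      · rw [heq v hv]
    · rw [smul_eq]
      exact Finset.sum_le_sum fun v _ => mul_le_mul_of_nonneg_right (hle v) (hf v)
end

section
/- Let E = (E⁰, E¹) be a finite directed graph with n vertices. Let E⁰₁ be the set of vertices at which some infinite path starts, and let E⁰₄ = E⁰ \ E⁰₁. Then there exists a bijection ν : E⁰ → {1, …, n} such that: (1) ν(v) < ν(w) whenever v ∈ E⁰₁ and w ∈ E⁰₄; (2) there is no edge e with s(e) ∈ E⁰₄, r(e) ∈ E⁰₄ and ν(r(e)) < ν(s(e)); (3) ν(v) < ν(w) whenever v is not a sink and w is a sink. -/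
/-- An infinite path starts at `v`: a sequence of edges `(p k)` with `s (p 0) = v` and
`s (p (k+1)) = r (p k)` for all `k`. -/
def HasInfinitePath {V E : Type*} (s r : E → V) (v : V) : Prop :=
  ∃ p : ℕ → E, s (p 0) = v ∧ ∀ k : ℕ, s (p (k + 1)) = r (p k)

/-- A function from a finite type to a linear order is refined by some numbering of the type. -/
theorem exists_equivFin_lt_of_lt {V α : Type*} [Fintype V] [LinearOrder α] (f : V → α) :
    ∃ ν : V ≃ Fin (Fintype.card V), ∀ v w, f v < f w → ν v < ν w := by
  let e := Fintype.equivFin V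
  refine ⟨e.trans (Tuple.sort (f ∘ e.symm)).symm, fun v w h ↦ ?_⟩
  by_contra! hle
  have hmono := Tuple.monotone_sort (f ∘ e.symm) hle
  simp only [Function.comp_apply, Equiv.trans_apply, Equiv.apply_symm_apply,
    Equiv.symm_apply_apply] at hmono
  exact hmono.not_gt h

/-- `EdgeTo s r w v` means that some edge goes from `v` to `w`. -/
def EdgeTo {V E : Type*} (s r : E → V) (w v : V) : Prop := ∃ e : E, s e = v ∧ r e = w

theorem not_acc_edgeTo_iff {V E : Type*} (s r : E → V) (v : V) :
    ¬ Acc (EdgeTo s r) v ↔ HasInfinitePath s r v := by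
  rw [not_acc_iff_exists_descending_chain]
  constructor
  · rintro ⟨f, h0, hf⟩
    choose p hs hr using hf
    exact ⟨p, by rw [hs, h0], fun k ↦ by rw [hs, hr]⟩
  · rintro ⟨p, h0, hp⟩
    exact ⟨fun k ↦ s (p k), h0, fun k ↦ ⟨p k, rfl, (hp k).symm⟩⟩

open Classical in
/-- The rank of a vertex with respect to the edge relation, and `⊤` where an infinite path
starts. -/
noncomputable def pathRank {V E : Type*} (s r : E → V) (v : V) : WithTop Ordinal :=
  if h : Acc (EdgeTo s r) v then (h.rank : WithTop Ordinal) else ⊤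

theorem pathRank_eq_top {V E : Type*} {s r : E → V} {v : V} (h : HasInfinitePath s r v) :
    pathRank s r v = ⊤ :=
  dif_neg ((not_acc_edgeTo_iff s r v).2 h)

theorem pathRank_lt_top {V E : Type*} {s r : E → V} {v : V} (h : ¬ HasInfinitePath s r v) :
    pathRank s r v < ⊤ := by
  rw [pathRank, dif_pos (by rwa [← not_acc_edgeTo_iff, not_not] at h)]
  exact WithTop.coe_lt_top _

theorem pathRank_range_lt_source {V E : Type*} {s r : E → V} {e : E}
    (h : ¬ HasInfinitePath s r (s e)) : pathRank s r (r e) < pathRank s r (s e) := by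
  rw [← not_acc_edgeTo_iff, not_not] at h
  have hr : EdgeTo s r (r e) (s e) := ⟨e, rfl, rfl⟩
  rw [pathRank, pathRank, dif_pos h, dif_pos (h.inv hr), WithTop.coe_lt_coe]
  exact Acc.rank_lt_of_rel h hr

theorem IsSink.not_hasInfinitePath {V E : Type*} {s : E → V} (r : E → V) {v : V}
    (h : IsSink s v) : ¬ HasInfinitePath s r v :=
  fun ⟨p, hp, _⟩ ↦ h ⟨p 0, hp⟩

theorem IsSink.pathRank_eq_zero {V E : Type*} {s : E → V} (r : E → V) {v : V}
    (h : IsSink s v) : pathRank s r v = 0 := by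
  have hv := h.not_hasInfinitePath r
  rw [← not_acc_edgeTo_iff, not_not] at hv
  have : IsEmpty { w // EdgeTo s r w v } := ⟨fun ⟨_, e, he, _⟩ ↦ h ⟨e, he⟩⟩
  rw [pathRank, dif_pos hv, hv.rank_eq, ciSup_of_empty]
  rfl

theorem pathRank_pos {V E : Type*} {s : E → V} (r : E → V) {v : V} (h : ¬ IsSink s v) :
    0 < pathRank s r v := by
  by_cases hv : HasInfinitePath s r v
  · rw [pathRank_eq_top hv]
    exact WithTop.coe_lt_top _
  · obtain ⟨e, rfl⟩ := not_not.1 h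
    exact bot_le.trans_lt (pathRank_range_lt_source hv)

/-- For a finite graph `E` with `n` vertices there is a bijective numbering
`ν : E⁰ → {1,…,n}` such that (1) vertices of `E⁰₁` (those at which an infinite path starts)
get smaller numbers than vertices of `E⁰₄ = E⁰ \ E⁰₁`; (2) there is no edge `e` with both
endpoints in `E⁰₄` and `ν(r e) < ν(s e)`; (3) non-sinks get smaller numbers than sinks. -/
theorem stmt8 {V E : Type*} [Fintype V] [Fintype E] (s r : E → V) :
    ∃ ν : V ≃ Fin (Fintype.card V),
      (∀ v w : V, HasInfinitePath s r v → ¬ HasInfinitePath s r w → ν v < ν w) ∧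
      (¬ ∃ e : E, ¬ HasInfinitePath s r (s e) ∧ ¬ HasInfinitePath s r (r e) ∧
        ν (r e) < ν (s e)) ∧
      (∀ v w : V, ¬ IsSink s v → IsSink s w → ν v < ν w) := by
  obtain ⟨ν, hν⟩ := exists_equivFin_lt_of_lt fun v ↦ OrderDual.toDual (pathRank s r v)
  refine ⟨ν, fun v w hv hw ↦ hν v w ?_, ?_, fun v w hv hw ↦ hν v w ?_⟩
  · rw [OrderDual.toDual_lt_toDual, pathRank_eq_top hv]
    exact pathRank_lt_top hw
  · rintro ⟨e, hs, -, hlt⟩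
    exact (hν _ _ (OrderDual.toDual_lt_toDual.2 (pathRank_range_lt_source hs))).not_gt hlt
  · rw [OrderDual.toDual_lt_toDual, hw.pathRank_eq_zero r]
    exact pathRank_pos r hv
end

section
/- Let E = (E⁰, E¹) be a finite directed graph without multiple edges, D its adjacency matrix, B = Dᵀ, and let β ∈ ℝ satisfy e^β > ρ(B). Let P : ℝ^{E⁰} → ℝ^{E⁰} be the coordinate projection onto the sink coordinates, i.e. (Pτ)(v) = τ(v) if v is a sink and (Pτ)(v) = 0 otherwise. Then for τ ∈ ℝ^{E⁰} the following are equivalent: (i) (Bτ)(w) = e^β τ(w) for every non-sink vertex w; (ii) (I − e^{-β}B)τ = Pτ; (iii) τ = Σ_{i=0}^∞ e^{-iβ} B^i (Pτ). In particular, such a τ is uniquely determined by its values on the sinks, and if Pτ has nonnegative entries then so does τ. -/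
instance {V E : Type*} [Fintype E] [DecidableEq V] (s : E → V) (v : V) :
    Decidable (IsSink s v) :=
  inferInstanceAs (Decidable ¬ ∃ e : E, s e = v)

open Filter in
/-- In a complex Banach algebra, the power series of `a` converges absolutely at the reciprocal of
any number exceeding the spectral radius of `a`. -/
theorem summable_inv_pow_mul_norm_pow {A : Type*} [NormedRing A] [NormedAlgebra ℂ A]
    [CompleteSpace A] {a : A} {R : ℝ} (h : spectralRadius ℂ a < ENNReal.ofReal R) :
    Summable fun n : ℕ => R⁻¹ ^ n * ‖a ^ n‖ := by
  have hR : 0 < R := ENNReal.ofReal_pos.1 (bot_le.trans_lt h)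
  obtain ⟨q, hq, hqR⟩ := ENNReal.lt_iff_exists_nnreal_btwn.1 h
  have hqR' : (q : ℝ) < R := by
    rwa [← ENNReal.ofReal_coe_nnreal, ENNReal.ofReal_lt_ofReal_iff hR] at hqR
  have hlt : R⁻¹ * (q : ℝ) < 1 := by
    rwa [inv_mul_lt_iff₀ hR, mul_one]
  refine Summable.of_norm_bounded_eventually_nat
    (summable_geometric_of_lt_one (by positivity) hlt) ?_
  filter_upwards [(spectrum.pow_norm_pow_one_div_tendsto_nhds_spectralRadius a).eventually_lt_const
    hq, eventually_gt_atTop 0] with n hn hn0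
  have hroot : ‖a ^ n‖ ^ (1 / n : ℝ) ≤ q := by
    rw [← ENNReal.ofReal_coe_nnreal] at hn
    exact (ENNReal.lt_ofReal_iff_toReal_lt ENNReal.ofReal_ne_top |>.1 hn |>.le).trans' <| by
      rw [ENNReal.toReal_ofReal (by positivity)]
  have hpow : ‖a ^ n‖ ≤ (q : ℝ) ^ n := by
    have := pow_le_pow_left₀ (by positivity) hroot n
    rwa [one_div, Real.rpow_inv_natCast_pow (norm_nonneg _) hn0.ne'] at this
  rw [Real.norm_of_nonneg (by positivity), mul_pow]
  gcongr

open Matrix.Norms.Operator in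
/-- The Neumann series of `R⁻¹ • M` converges when `R` exceeds the spectral radius of `M`. -/
theorem Matrix.summable_inv_smul_pow {V : Type*} [Fintype V] [DecidableEq V] {M : Matrix V V ℝ}
    {R : ℝ} (h : spectralRadius ℂ (M.map (Complex.ofReal ·)) < ENNReal.ofReal R) :
    Summable fun n : ℕ => (R⁻¹ • M) ^ n := by
  have hnorm := summable_inv_pow_mul_norm_pow h
  refine Pi.summable.2 fun i => Pi.summable.2 fun j => Summable.of_norm_bounded hnorm fun n => ?_
  have hmap : (M.map (Complex.ofReal ·)) ^ n = (M ^ n).map Complex.ofRealHom :=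
    (map_pow Complex.ofRealHom.mapMatrix M n).symm
  have hR : 0 < R := ENNReal.ofReal_pos.1 (bot_le.trans_lt h)
  rw [smul_pow, Matrix.smul_apply, norm_smul, Real.norm_of_nonneg (by positivity)]
  gcongr
  rw [hmap, Matrix.linfty_opNorm_def]
  have hrow : ∑ k, ‖(M ^ n).map Complex.ofRealHom i k‖₊ ≤
      Finset.univ.sup fun i => ∑ k, ‖(M ^ n).map Complex.ofRealHom i k‖₊ :=
    Finset.le_sup (f := fun i => ∑ k, ‖(M ^ n).map Complex.ofRealHom i k‖₊) (Finset.mem_univ i)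
  have hentry : ‖(M ^ n).map Complex.ofRealHom i j‖₊ ≤
      ∑ k, ‖(M ^ n).map Complex.ofRealHom i k‖₊ :=
    Finset.single_le_sum (f := fun k => ‖(M ^ n).map Complex.ofRealHom i k‖₊)
      (fun _ _ => zero_le) (Finset.mem_univ j)
  simpa using! NNReal.coe_le_coe.2 (hentry.trans hrow)

/-- If the Neumann series of `M` converges, then it inverts `1 - M` on vectors. -/
theorem Matrix.one_sub_mulVec_eq_iff_eq_tsum {V : Type*} [Fintype V] [DecidableEq V]
    {M : Matrix V V ℝ} (h : Summable fun n : ℕ => M ^ n) (x y : V → ℝ) :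
    (1 - M).mulVec x = y ↔ x = ∑' n : ℕ, (M ^ n).mulVec y := by
  have hsum : ∑' n : ℕ, (M ^ n).mulVec y = (∑' n : ℕ, M ^ n).mulVec y :=
    (h.hasSum.map (Matrix.mulVec.addMonoidHomLeft y)
      (continuous_id.matrix_mulVec continuous_const)).tsum_eq
  rw [hsum]
  constructor
  · rintro rfl
    rw [Matrix.mulVec_mulVec, h.tsum_pow_mul_one_sub, Matrix.one_mulVec]
  · rintro rfl
    rw [Matrix.mulVec_mulVec, h.one_sub_mul_tsum_pow, Matrix.one_mulVec]

theorem adjMatrix_transpose_mulVec_of_isSink {V E : Type*} [Fintype V] [Fintype E]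
    [DecidableEq V] {s r : E → V} {v : V} (hv : IsSink s v) (x : V → ℝ) :
    (adjMatrix ℝ s r).transpose.mulVec x v = 0 := by
  refine Finset.sum_eq_zero fun w _ => ?_
  have : ¬ ∃ e : E, s e = v ∧ r e = w := fun ⟨e, he, _⟩ => hv ⟨e, he⟩
  simp [adjMatrix, this]

theorem adjMatrix_transpose_pow_nonneg {V E : Type*} [Fintype V] [Fintype E]
    [DecidableEq V] (s r : E → V) (n : ℕ) (v w : V) :
    0 ≤ ((adjMatrix ℝ s r).transpose ^ n) v w := by
  induction n generalizing v w with
  | zero => rw [pow_zero, Matrix.one_apply]; split_ifs <;> norm_num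
  | succ n ih =>
    rw [pow_succ, Matrix.mul_apply]
    refine Finset.sum_nonneg fun u _ => mul_nonneg (ih v u) ?_
    simp only [adjMatrix, Matrix.transpose_apply, Matrix.of_apply]
    split_ifs <;> norm_num

/-- Let `B = Dᵀ` for a finite graph without multiple edges and let
`e^β > ρ(B)`.  With `P` the coordinate projection onto the sink coordinates, the following
are equivalent for `τ ∈ ℝ^{E⁰}`: (i) `(Bτ)(w) = e^β τ(w)` at every non-sink `w`;
(ii) `(I − e^{-β}B)τ = Pτ`; (iii) `τ = Σ_i e^{-iβ} Bⁱ (Pτ)`.  In particular such a `τ` is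
determined by its values on sinks, and if `Pτ ≥ 0` then `τ ≥ 0`. -/
theorem stmt11 {V E : Type*} [Fintype V] [Fintype E] [DecidableEq V]
    (s r : E → V)
    (hsimple : ∀ e e' : E, s e = s e' → r e = r e' → e = e')
    (β : ℝ)
    (hρ : spectralRadius ℂ
        (((adjMatrix ℝ s r).transpose).map (Complex.ofReal ·)) <
      ENNReal.ofReal (Real.exp β)) :
    ∀ τ : V → ℝ,
      (((∀ w : V, ¬ IsSink s w →
            (adjMatrix ℝ s r).transpose.mulVec τ w = Real.exp β * τ w) ↔
          ((1 - Real.exp (-β) • (adjMatrix ℝ s r).transpose).mulVec τ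
            = fun v => if IsSink s v then τ v else 0)) ∧
        (((1 - Real.exp (-β) • (adjMatrix ℝ s r).transpose).mulVec τ
            = fun v => if IsSink s v then τ v else 0) ↔
          (τ = ∑' i : ℕ, Real.exp (-β) ^ i •
            ((adjMatrix ℝ s r).transpose ^ i).mulVec
              (fun v => if IsSink s v then τ v else 0)))) ∧
      (∀ τ' : V → ℝ,
        (∀ w : V, ¬ IsSink s w →
          (adjMatrix ℝ s r).transpose.mulVec τ w = Real.exp β * τ w) →
        (∀ w : V, ¬ IsSink s w →
          (adjMatrix ℝ s r).transpose.mulVec τ' w = Real.exp β * τ' w) →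
        (∀ v : V, IsSink s v → τ v = τ' v) → τ = τ') ∧
      ((∀ w : V, ¬ IsSink s w →
          (adjMatrix ℝ s r).transpose.mulVec τ w = Real.exp β * τ w) →
        (∀ v : V, IsSink s v → 0 ≤ τ v) → ∀ v : V, 0 ≤ τ v) := by
  intro τ
  have hS := Matrix.summable_inv_smul_pow hρ
  rw [← Real.exp_neg] at hS
  have eigen_iff : ∀ x : V → ℝ, (∀ w : V, ¬ IsSink s w →
      (adjMatrix ℝ s r).transpose.mulVec x w = Real.exp β * x w) ↔
      (1 - Real.exp (-β) • (adjMatrix ℝ s r).transpose).mulVec x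
        = fun v => if IsSink s v then x v else 0 := by
    intro x
    rw [funext_iff]
    refine forall_congr' fun w => ?_
    rw [Matrix.sub_mulVec, Matrix.one_mulVec, Matrix.smul_mulVec, Pi.sub_apply, Pi.smul_apply,
      smul_eq_mul]
    by_cases hw : IsSink s w
    · simp [hw, adjMatrix_transpose_mulVec_of_isSink hw]
    · simp only [hw, not_false_eq_true, forall_const, if_false]
      rw [Real.exp_neg, sub_eq_zero, eq_inv_mul_iff_mul_eq₀ (Real.exp_ne_zero β)]
      exact eq_comm
  have tsum_iff : ∀ x : V → ℝ, (1 - Real.exp (-β) • (adjMatrix ℝ s r).transpose).mulVec x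
        = (fun v => if IsSink s v then x v else 0) ↔
      x = ∑' i : ℕ, Real.exp (-β) ^ i • ((adjMatrix ℝ s r).transpose ^ i).mulVec
        (fun v => if IsSink s v then x v else 0) := by
    intro x
    simp_rw [Matrix.one_sub_mulVec_eq_iff_eq_tsum hS, smul_pow, Matrix.smul_mulVec]
  refine ⟨⟨eigen_iff τ, tsum_iff τ⟩, fun τ' h h' hsink => ?_, fun h hsink => ?_⟩
  · rw [eigen_iff, tsum_iff] at h h'
    have hP : (fun v => if IsSink s v then τ v else 0) =
        fun v => if IsSink s v then τ' v else 0 :=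
      funext fun v => ite_congr rfl (hsink v) fun _ => rfl
    rw [hP, ← h'] at h
    exact h
  · rw [eigen_iff, tsum_iff] at h
    suffices 0 ≤ τ from this
    rw [h]
    refine tsum_nonneg fun i => smul_nonneg (by positivity) fun v =>
      Finset.sum_nonneg fun w _ => mul_nonneg (adjMatrix_transpose_pow_nonneg s r i v w) ?_
    beta_reduce
    split_ifs with hw
    exacts [hsink w hw, le_rfl]
end

section
/- Let E = (E⁰, E¹) be a finite directed graph without multiple edges containing no directed cycle, D its adjacency matrix and B = Dᵀ. Then for every β > 0, the set of extreme points of S_β = { τ ∈ ℝ^{E⁰} : τ ≥ 0, Σ_v τ(v) = 1, (Bτ)(w) = e^β τ(w) for every non-sink w } is exactly { τ_v : v a sink of E }, where τ_v is the normalization of σ_v = Σ_{i=0}^∞ e^{-iβ} B^i δ_v, and v ↦ τ_v is injective on the set of sinks. -/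
/-- The set `S_β` of normalized nonnegative vectors `τ` with `(Bτ)(w) = e^β τ(w)` at every
non-sink vertex `w`; it corresponds to the set of `β`-KMS states on the graph C*-algebra. -/
def KMSVectors {V E : Type*} [Fintype V] [Fintype E] [DecidableEq V]
    (s r : E → V) (β : ℝ) : Set (V → ℝ) :=
  {τ | (∀ v, 0 ≤ τ v) ∧ (∑ v : V, τ v) = 1 ∧
    ∀ w : V, ¬ IsSink s w → (adjMatrix ℝ s r).transpose.mulVec τ w = Real.exp β * τ w}

/-- `σ_v = Σ_i e^{-iβ} Bⁱ δ_v`. -/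
noncomputable def sigmaVec {V E : Type*} [Fintype V] [Fintype E] [DecidableEq V]
    (s r : E → V) (β : ℝ) (v : V) : V → ℝ :=
  ∑' i : ℕ, Real.exp (-β) ^ i • ((adjMatrix ℝ s r).transpose ^ i).mulVec (Pi.single v 1)

/-- `τ_v`, the normalization of `σ_v`. -/
noncomputable def tauVec {V E : Type*} [Fintype V] [Fintype E] [DecidableEq V]
    (s r : E → V) (β : ℝ) (v : V) : V → ℝ :=
  (∑ u : V, sigmaVec s r β v u)⁻¹ • sigmaVec s r β v

open scoped Matrix

/-- A finite directed graph without directed cycles has a well-founded edge relation: every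
property that passes from the out-neighbours of a vertex to the vertex holds everywhere. -/
theorem wellFounded_of_no_directed_cycle {V E : Type*} [Finite V] (s r : E → V)
    (hnocycle : ¬ ∃ (k : ℕ) (p : ℕ → E),
      (∀ j : ℕ, j < k → s (p (j + 1)) = r (p j)) ∧ r (p k) = s (p 0)) :
    WellFounded fun u w : V => ∃ e : E, s e = w ∧ r e = u := by
  set R : V → V → Prop := fun u w => ∃ e : E, s e = w ∧ r e = u with hR
  have path : ∀ u w, Relation.TransGen R u w → ∃ (k : ℕ) (p : ℕ → E),
      (∀ j : ℕ, j < k → s (p (j + 1)) = r (p j)) ∧ s (p 0) = w ∧ r (p k) = u := by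
    intro u w h
    induction h with
    | single h =>
      obtain ⟨e, hs, hr⟩ := h
      exact ⟨0, fun _ => e, by simp, hs, hr⟩
    | tail _ h ih =>
      obtain ⟨k, p, hp, hp0, hpk⟩ := ih
      obtain ⟨e, hs, hr⟩ := h
      refine ⟨k + 1, fun j => Nat.casesOn j e p, ?_, hs, hpk⟩
      rintro (_ | j) hj
      · exact hp0.trans hr.symm
      · exact hp j (by omega)
  have irrefl : Std.Irrefl (Relation.TransGen R) := by
    refine ⟨fun a h => hnocycle ?_⟩
    obtain ⟨k, p, hp, hp0, hpk⟩ := path a a h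
    exact ⟨k, p, hp, hpk.trans hp0.symm⟩
  have : WellFounded (Relation.TransGen R) := Finite.wellFounded_of_trans_of_irrefl _
  exact Subrelation.wf (fun h => Relation.TransGen.single h) this

section

variable {V E : Type*} [Fintype E] [DecidableEq V] {s r : E → V}

theorem adjMatrix_transpose_nonneg (w u : V) : 0 ≤ (adjMatrix ℝ s r)ᵀ w u := by
  simp only [adjMatrix, Matrix.transpose_apply, Matrix.of_apply]
  split_ifs <;> norm_num

theorem adjMatrix_transpose_apply_of_not_edge {w u : V} (h : ¬ ∃ e : E, s e = w ∧ r e = u) :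
    (adjMatrix ℝ s r)ᵀ w u = 0 := by
  simp only [adjMatrix, Matrix.transpose_apply, Matrix.of_apply, if_neg h]

variable [Fintype V]

theorem adjMatrix_transpose_mulVec_of_isSink_s13 {w : V} (hw : IsSink s w) (f : V → ℝ) :
    ((adjMatrix ℝ s r)ᵀ *ᵥ f) w = 0 :=
  Finset.sum_eq_zero fun u _ =>
    mul_eq_zero_of_left
      (adjMatrix_transpose_apply_of_not_edge fun ⟨e, he, _⟩ => hw ⟨e, he⟩) (f u)

theorem exists_adjMatrix_transpose_pow_eq_zero
    (hwf : WellFounded fun u w : V => ∃ e : E, s e = w ∧ r e = u) :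
    ∃ N : ℕ, ∀ m ≥ N, (adjMatrix ℝ s r)ᵀ ^ m = 0 := by
  have row : ∀ w : V, ∃ n : ℕ, ∀ m ≥ n, ∀ u, ((adjMatrix ℝ s r)ᵀ ^ m) w u = 0 := by
    intro w
    induction w using hwf.induction with
    | _ w ih =>
      choose! n hn using ih
      refine ⟨Finset.univ.sup n + 1, fun m hm u => ?_⟩
      obtain ⟨m, rfl⟩ : ∃ k, m = k + 1 := ⟨m - 1, by omega⟩
      rw [pow_succ', Matrix.mul_apply]
      refine Finset.sum_eq_zero fun x _ => ?_
      by_cases hx : ∃ e : E, s e = w ∧ r e = x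
      · have : n x ≤ Finset.univ.sup n := Finset.le_sup (Finset.mem_univ x)
        rw [hn x hx m (by omega) u, mul_zero]
      · rw [adjMatrix_transpose_apply_of_not_edge hx, zero_mul]
  choose n hn using row
  refine ⟨Finset.univ.sup n, fun m hm => ?_⟩
  ext w u
  exact hn w m ((Finset.le_sup (Finset.mem_univ w)).trans hm) u

/-- `σ_v = δ_v + e^{-β} B σ_v`. -/
theorem sigmaVec_eq_single_add
    (hwf : WellFounded fun u w : V => ∃ e : E, s e = w ∧ r e = u) (β : ℝ) (v : V) :
    sigmaVec s r β v =
      Pi.single v 1 + Real.exp (-β) • ((adjMatrix ℝ s r)ᵀ *ᵥ sigmaVec s r β v) := by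
  obtain ⟨N, hN⟩ := exists_adjMatrix_transpose_pow_eq_zero hwf
  have key : ∀ M ≥ N, sigmaVec s r β v = ∑ i ∈ Finset.range M,
      Real.exp (-β) ^ i • (((adjMatrix ℝ s r)ᵀ ^ i) *ᵥ Pi.single v 1) := by
    intro M hM
    refine tsum_eq_sum fun i hi => ?_
    rw [hN i (by simp at hi; omega), Matrix.zero_mulVec, smul_zero]
  conv_lhs => rw [key (N + 1) (by omega), Finset.sum_range_succ']
  rw [key N le_rfl, Matrix.mulVec_sum, Finset.smul_sum, add_comm]
  simp only [pow_zero, Matrix.one_mulVec, one_smul, Matrix.mulVec_smul, Matrix.mulVec_mulVec,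
    smul_smul, ← pow_succ']

/-- A vector vanishing at the sinks and satisfying the eigenvector equation at the other
vertices is zero. -/
theorem eq_zero_of_forall_isSink
    (hwf : WellFounded fun u w : V => ∃ e : E, s e = w ∧ r e = u) {β : ℝ} {f : V → ℝ}
    (hsink : ∀ w, IsSink s w → f w = 0)
    (hf : ∀ w, ¬ IsSink s w → ((adjMatrix ℝ s r)ᵀ *ᵥ f) w = Real.exp β * f w) : f = 0 := by
  funext w
  induction w using hwf.induction with
  | _ w ih =>
    by_cases hw : IsSink s w
    · exact hsink w hw
    · have h : ((adjMatrix ℝ s r)ᵀ *ᵥ f) w = 0 := Finset.sum_eq_zero fun u _ => by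
        by_cases hu : ∃ e : E, s e = w ∧ r e = u
        · rw [ih u hu, Pi.zero_apply, mul_zero]
        · exact mul_eq_zero_of_left (adjMatrix_transpose_apply_of_not_edge hu) (f u)
      rw [hf w hw] at h
      exact (mul_eq_zero.mp h).resolve_left (Real.exp_ne_zero β)

theorem sigmaVec_nonneg
    (hwf : WellFounded fun u w : V => ∃ e : E, s e = w ∧ r e = u) (β : ℝ) (v w : V) :
    0 ≤ sigmaVec s r β v w := by
  induction w using hwf.induction with
  | _ w ih =>
    rw [sigmaVec_eq_single_add hwf]
    refine add_nonneg ?_ (mul_nonneg (Real.exp_pos _).le (Finset.sum_nonneg fun u _ => ?_))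
    · rw [Pi.single_apply]
      split_ifs <;> norm_num
    · by_cases hu : ∃ e : E, s e = w ∧ r e = u
      · exact mul_nonneg (adjMatrix_transpose_nonneg w u) (ih u hu)
      · exact (mul_eq_zero_of_left (adjMatrix_transpose_apply_of_not_edge hu) _).ge

theorem sigmaVec_apply_of_isSink
    (hwf : WellFounded fun u w : V => ∃ e : E, s e = w ∧ r e = u) (β : ℝ) (v : V) {w : V}
    (hw : IsSink s w) : sigmaVec s r β v w = if w = v then 1 else 0 := by
  rw [sigmaVec_eq_single_add hwf, Pi.add_apply, Pi.smul_apply,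
    adjMatrix_transpose_mulVec_of_isSink_s13 hw, smul_zero, add_zero, Pi.single_apply]

theorem mulVec_sigmaVec_of_not_isSink
    (hwf : WellFounded fun u w : V => ∃ e : E, s e = w ∧ r e = u) (β : ℝ) {v w : V}
    (hv : IsSink s v) (hw : ¬ IsSink s w) :
    ((adjMatrix ℝ s r)ᵀ *ᵥ sigmaVec s r β v) w = Real.exp β * sigmaVec s r β v w := by
  have hne : w ≠ v := fun h => hw (h ▸ hv)
  have h := congrFun (sigmaVec_eq_single_add hwf β v) w
  rw [Pi.add_apply, Pi.smul_apply, Pi.single_eq_of_ne hne, zero_add, smul_eq_mul] at h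
  rw [h, ← mul_assoc, ← Real.exp_add, add_neg_cancel, Real.exp_zero, one_mul]

theorem sum_sigmaVec_pos
    (hwf : WellFounded fun u w : V => ∃ e : E, s e = w ∧ r e = u) (β : ℝ) {v : V}
    (hv : IsSink s v) : 0 < ∑ u, sigmaVec s r β v u := by
  refine Finset.sum_pos' (fun u _ => sigmaVec_nonneg hwf β v u) ⟨v, Finset.mem_univ v, ?_⟩
  rw [sigmaVec_apply_of_isSink hwf β v hv, if_pos rfl]
  exact one_pos

theorem tauVec_mem_KMSVectors
    (hwf : WellFounded fun u w : V => ∃ e : E, s e = w ∧ r e = u) (β : ℝ) {v : V}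
    (hv : IsSink s v) : tauVec s r β v ∈ KMSVectors s r β := by
  have hpos := sum_sigmaVec_pos hwf β hv
  refine ⟨fun w => mul_nonneg (inv_nonneg.mpr hpos.le) (sigmaVec_nonneg hwf β v w), ?_,
    fun w hw => ?_⟩
  · simp only [tauVec, Pi.smul_apply, smul_eq_mul, ← Finset.mul_sum]
    exact inv_mul_cancel₀ hpos.ne'
  · rw [tauVec, Matrix.mulVec_smul, Pi.smul_apply, Pi.smul_apply,
      mulVec_sigmaVec_of_not_isSink hwf β hv hw, smul_eq_mul, smul_eq_mul, mul_left_comm]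

theorem tauVec_apply_eq_zero_of_ne
    (hwf : WellFounded fun u w : V => ∃ e : E, s e = w ∧ r e = u) (β : ℝ) {v w : V}
    (hw : IsSink s w) (hne : w ≠ v) : tauVec s r β v w = 0 := by
  rw [tauVec, Pi.smul_apply, sigmaVec_apply_of_isSink hwf β v hw, if_neg hne, smul_zero]

theorem tauVec_self_ne_zero
    (hwf : WellFounded fun u w : V => ∃ e : E, s e = w ∧ r e = u) (β : ℝ) {v : V}
    (hv : IsSink s v) : tauVec s r β v v ≠ 0 := by
  rw [tauVec, Pi.smul_apply, sigmaVec_apply_of_isSink hwf β v hv, if_pos rfl, smul_eq_mul,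
    mul_one]
  exact inv_ne_zero (sum_sigmaVec_pos hwf β hv).ne'

/-- An element of `S_β` is determined by its values at the sinks. -/
theorem eq_sum_smul_sigmaVec
    (hwf : WellFounded fun u w : V => ∃ e : E, s e = w ∧ r e = u) {β : ℝ} {τ : V → ℝ}
    (hτ : τ ∈ KMSVectors s r β) :
    τ = ∑ v with IsSink s v, τ v • sigmaVec s r β v := by
  rw [← sub_eq_zero]
  refine eq_zero_of_forall_isSink hwf (β := β) (fun w hw => ?_) fun w hw => ?_
  · have h : ∀ v, τ v * sigmaVec s r β v w = if w = v then τ v else 0 := fun v => by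
      rw [sigmaVec_apply_of_isSink hwf β v hw, mul_ite, mul_one, mul_zero]
    simp [Finset.sum_apply, h, hw]
  · rw [Matrix.mulVec_sub, Matrix.mulVec_sum, Pi.sub_apply, Pi.sub_apply, hτ.2.2 w hw, mul_sub,
      Finset.sum_apply, Finset.sum_apply, Finset.mul_sum]
    congr 1
    refine Finset.sum_congr rfl fun v hv => ?_
    rw [Matrix.mulVec_smul, Pi.smul_apply, Pi.smul_apply,
      mulVec_sigmaVec_of_not_isSink hwf β (Finset.mem_filter.mp hv).2 hw, smul_eq_mul,
      smul_eq_mul, mul_left_comm]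

theorem eq_tauVec_of_forall_ne
    (hwf : WellFounded fun u w : V => ∃ e : E, s e = w ∧ r e = u) {β : ℝ} {τ : V → ℝ}
    (hτ : τ ∈ KMSVectors s r β) {v : V} (hv : IsSink s v)
    (h : ∀ w, IsSink s w → w ≠ v → τ w = 0) : τ = tauVec s r β v := by
  have hσ : τ = τ v • sigmaVec s r β v := by
    conv_lhs => rw [eq_sum_smul_sigmaVec hwf hτ]
    refine Finset.sum_eq_single_of_mem v (by simp [hv]) fun w hw hne => ?_
    rw [h w (Finset.mem_filter.mp hw).2 hne, zero_smul]
  have hsum : τ v * ∑ u, sigmaVec s r β v u = 1 := by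
    rw [← hτ.2.1, Finset.mul_sum]
    exact Finset.sum_congr rfl fun u _ => (congrFun hσ u).symm
  rw [tauVec, ← eq_inv_of_mul_eq_one_left hsum]
  exact hσ

theorem convex_KMSVectors (β : ℝ) : Convex ℝ (KMSVectors s r β) := by
  intro x hx y hy a b ha hb hab
  refine ⟨fun v => add_nonneg (mul_nonneg ha (hx.1 v)) (mul_nonneg hb (hy.1 v)), ?_,
    fun w hw => ?_⟩
  · simp only [Pi.add_apply, Pi.smul_apply, smul_eq_mul, Finset.sum_add_distrib,
      ← Finset.mul_sum, hx.2.1, hy.2.1, mul_one, hab]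
  · simp only [Matrix.mulVec_add, Matrix.mulVec_smul, Pi.add_apply, Pi.smul_apply, smul_eq_mul,
      hx.2.2 w hw, hy.2.2 w hw]
    ring

theorem KMSVectors_eq_convexHull
    (hwf : WellFounded fun u w : V => ∃ e : E, s e = w ∧ r e = u) (β : ℝ) :
    KMSVectors s r β = convexHull ℝ (tauVec s r β '' {v : V | IsSink s v}) := by
  refine Set.Subset.antisymm (fun τ hτ => ?_) (convexHull_min ?_ (convex_KMSVectors β))
  · have hτ_eq := eq_sum_smul_sigmaVec hwf hτ
    have hcomb : τ = ∑ v with IsSink s v,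
        (τ v * ∑ u, sigmaVec s r β v u) • tauVec s r β v := by
      conv_lhs => rw [hτ_eq]
      refine Finset.sum_congr rfl fun v hv => ?_
      rw [tauVec, smul_smul, mul_assoc,
        mul_inv_cancel₀ (sum_sigmaVec_pos hwf β (Finset.mem_filter.mp hv).2).ne', mul_one]
    rw [hcomb]
    refine (convex_convexHull ℝ _).sum_mem (fun v hv => ?_) ?_ fun v hv => ?_
    · exact mul_nonneg (hτ.1 v) (sum_sigmaVec_pos hwf β (Finset.mem_filter.mp hv).2).le
    · rw [← hτ.2.1]
      conv_rhs => rw [hτ_eq]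
      simp only [Finset.sum_apply, Pi.smul_apply, smul_eq_mul, Finset.mul_sum]
      exact Finset.sum_comm
    · exact subset_convexHull ℝ _ ⟨v, (Finset.mem_filter.mp hv).2, rfl⟩
  · rintro _ ⟨v, hv, rfl⟩
    exact tauVec_mem_KMSVectors hwf β hv

theorem tauVec_mem_extremePoints
    (hwf : WellFounded fun u w : V => ∃ e : E, s e = w ∧ r e = u) (β : ℝ) {v : V}
    (hv : IsSink s v) : tauVec s r β v ∈ Set.extremePoints ℝ (KMSVectors s r β) := by
  refine mem_extremePoints_iff_left.mpr ⟨tauVec_mem_KMSVectors hwf β hv, ?_⟩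
  rintro x hx y hy ⟨a, b, ha, hb, -, hxy⟩
  refine eq_tauVec_of_forall_ne hwf hx hv fun w hw hne => ?_
  have h := congrFun hxy w
  rw [tauVec_apply_eq_zero_of_ne hwf β hw hne, Pi.add_apply, Pi.smul_apply, Pi.smul_apply,
    smul_eq_mul, smul_eq_mul] at h
  have hax := ((add_eq_zero_iff_of_nonneg (mul_nonneg ha.le (hx.1 w))
    (mul_nonneg hb.le (hy.1 w))).mp h).1
  exact (mul_eq_zero.mp hax).resolve_left ha.ne'

end

/-- For a finite graph without multiple edges containing no directed
cycle, for every `β > 0` the extreme points of `S_β` are exactly the vectors `τ_v` for `v` a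
sink, and `v ↦ τ_v` is injective on the set of sinks. -/
theorem stmt13 {V E : Type*} [Fintype V] [Fintype E] [DecidableEq V]
    (s r : E → V)
    (hsimple : ∀ e e' : E, s e = s e' → r e = r e' → e = e')
    (hnocycle : ¬ ∃ (k : ℕ) (p : ℕ → E),
      (∀ j : ℕ, j < k → s (p (j + 1)) = r (p j)) ∧ r (p k) = s (p 0))
    (β : ℝ) (hβ : 0 < β) :
    Set.InjOn (tauVec s r β) {v : V | IsSink s v} ∧
    Set.extremePoints ℝ (KMSVectors s r β) = tauVec s r β '' {v : V | IsSink s v} := by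
  have hwf := wellFounded_of_no_directed_cycle s r hnocycle
  refine ⟨fun v hv w hw h => ?_, Set.Subset.antisymm ?_ ?_⟩
  · by_contra hne
    refine tauVec_self_ne_zero hwf β hv ?_
    rw [h]
    exact tauVec_apply_eq_zero_of_ne hwf β hv hne
  · rw [KMSVectors_eq_convexHull hwf]
    exact extremePoints_convexHull_subset
  · rintro _ ⟨v, hv, rfl⟩
    exact tauVec_mem_extremePoints hwf β hv
end

section
/- Let E = (E⁰, E¹) be a finite directed graph without multiple edges containing a directed cycle, D its adjacency matrix and B = Dᵀ. Let E⁰₁ be the (nonempty) set of vertices at which an infinite path starts, and let B₁₁ be the submatrix of B with rows and columns indexed by E⁰₁. Let λ₀ = ρ(B₁₁) be the spectral radius of B₁₁ (its Perron–Frobenius eigenvalue), and suppose τ̂₁ ∈ ℝ^{E⁰₁} satisfies τ̂₁ ≥ 0 entrywise, Σ_{v∈E⁰₁} τ̂₁(v) = 1, and B₁₁ τ̂₁ = λ₀ τ̂₁. Then the vector τ ∈ ℝ^{E⁰} obtained by extending τ̂₁ by zero on E⁰ \ E⁰₁ satisfies: τ ≥ 0, Σ_v τ(v) = 1, and (Bτ)(w)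 = λ₀ · τ(w) for every non-sink vertex w of E; that is, τ ∈ S_β for β = log λ₀. -/
/-- Extension by zero of a function defined on a subset of the vertices. -/
def extendByZero {V : Type*} (P : V → Prop) [DecidablePred P] (f : {v // P v} → ℝ) :
    V → ℝ :=
  fun v => if h : P v then f ⟨v, h⟩ else 0

section SpectralRadius

attribute [local instance] Matrix.linftyOpNormedRing Matrix.linftyOpNormedAlgebra

/-- A nonnegative real matrix all of whose row sums are at least `1` has spectral radius
at least `1`. -/
theorem one_le_spectralRadius_of_one_le_mulVec_one {ι : Type*} [Fintype ι] [DecidableEq ι]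
    [Nonempty ι] (A : Matrix ι ι ℝ) (hA : ∀ i j, 0 ≤ A i j) (hrow : ∀ i, 1 ≤ A.mulVec 1 i) :
    1 ≤ spectralRadius ℂ (A.map (Complex.ofReal ·)) := by
  set C : Matrix ι ι ℂ := A.map (Complex.ofReal ·) with hC
  have hpow : ∀ n : ℕ, ∃ u : ι → ℝ, (∀ i, 1 ≤ u i) ∧
      (C ^ n).mulVec 1 = fun i => (u i : ℂ) := by
    intro n
    induction n with
    | zero => exact ⟨1, fun _ => le_rfl, by ext i; simp⟩
    | succ n ih =>
      obtain ⟨u, hu, hCu⟩ := ih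
      refine ⟨A.mulVec u, fun i => (hrow i).trans ?_, ?_⟩
      · exact Finset.sum_le_sum fun j _ => mul_le_mul_of_nonneg_left (hu j) (hA i j)
      · rw [pow_succ', ← Matrix.mulVec_mulVec, hCu]
        ext i
        simp [hC, Matrix.mulVec, dotProduct]
  have hnorm : ∀ n : ℕ, (1 : NNReal) ≤ ‖C ^ n‖₊ := by
    intro n
    obtain ⟨u, hu, hCu⟩ := hpow n
    obtain ⟨i⟩ := ‹Nonempty ι›
    have hle := Matrix.linfty_opNNNorm_mulVec (C ^ n) 1
    have hone : ‖(1 : ι → ℂ)‖₊ ≤ 1 := by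
      rw [pi_nnnorm_le_iff]
      simp
    have hi : (1 : NNReal) ≤ ‖(C ^ n).mulVec 1‖₊ := by
      refine le_trans ?_ (nnnorm_le_pi_nnnorm _ i)
      rw [hCu, ← NNReal.coe_le_coe]
      simpa using (hu i).trans (le_abs_self _)
    calc (1 : NNReal) ≤ ‖C ^ n‖₊ * ‖(1 : ι → ℂ)‖₊ := hi.trans hle
      _ ≤ ‖C ^ n‖₊ * 1 := by gcongr
      _ = ‖C ^ n‖₊ := mul_one _
  refine ge_of_tendsto' (spectrum.pow_nnnorm_pow_one_div_tendsto_nhds_spectralRadius C) ?_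
  intro n
  rw [← ENNReal.one_rpow (1 / (n : ℝ))]
  exact ENNReal.rpow_le_rpow (by exact_mod_cast hnorm n) (by positivity)

end SpectralRadius

/-- The source of an edge whose range starts an infinite path starts one too. -/
theorem HasInfinitePath.of_range {V E : Type*} {s r : E → V} (e : E)
    (h : HasInfinitePath s r (r e)) : HasInfinitePath s r (s e) := by
  obtain ⟨p, hp0, hp⟩ := h
  refine ⟨fun n => Nat.casesOn n e p, rfl, fun k => ?_⟩
  cases k with
  | zero => exact hp0
  | succ k => exact hp k

/-- A vertex starting an infinite path has an outgoing edge to another such vertex. -/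
theorem HasInfinitePath.exists_edge {V E : Type*} {s r : E → V} {v : V}
    (h : HasInfinitePath s r v) : ∃ e : E, s e = v ∧ HasInfinitePath s r (r e) := by
  obtain ⟨p, hp0, hp⟩ := h
  exact ⟨p 0, hp0, fun k => p (k + 1), hp 0, fun k => hp (k + 1)⟩

theorem adjMatrix_nonneg {V E : Type*} [Fintype E] [DecidableEq V] (s r : E → V) (i j : V) :
    0 ≤ adjMatrix ℝ s r i j := by
  simp only [adjMatrix, Matrix.of_apply]
  split_ifs <;> norm_num

/-- Summing a function against an extension by zero only sees the subset. -/
theorem sum_mul_extendByZero {V : Type*} [Fintype V] (P : V → Prop) [DecidablePred P]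
    (g : V → ℝ) (f : {v // P v} → ℝ) :
    ∑ v, g v * extendByZero P f v = ∑ x : {v // P v}, g x * f x := by
  rw [← Fintype.sum_subtype_add_sum_subtype P]
  have hpos (x : {v // P v}) : extendByZero P f x = f x := dif_pos x.2
  have hneg (x : {v // ¬ P v}) : extendByZero P f x = 0 := dif_neg x.2
  simp [hpos, hneg]

/-- Let `E` be a finite graph without multiple edges containing a directed
cycle, `E⁰₁` the (nonempty) set of vertices at which an infinite path starts, `B₁₁` the
corresponding submatrix of `B = Dᵀ`, and `λ₀ = ρ(B₁₁)` its Perron–Frobenius eigenvalue.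
If `τ̂₁ ≥ 0` is a normalized Perron–Frobenius eigenvector of `B₁₁` (`B₁₁ τ̂₁ = λ₀ τ̂₁`),
then its extension `τ` by zero satisfies `τ ≥ 0`, `Σ_v τ(v) = 1` and
`(Bτ)(w) = λ₀ τ(w)` for every non-sink `w`; that is, `τ ∈ S_β` for `β = log λ₀`. -/
theorem stmt14 {V E : Type*} [Fintype V] [Fintype E] [DecidableEq V]
    (s r : E → V) [DecidablePred (HasInfinitePath s r)]
    (hsimple : ∀ e e' : E, s e = s e' → r e = r e' → e = e')
    (hcycle : ∃ (k : ℕ) (p : ℕ → E),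
      (∀ j : ℕ, j < k → s (p (j + 1)) = r (p j)) ∧ r (p k) = s (p 0))
    (lam : ℝ) (hlam_nonneg : 0 ≤ lam)
    (hlam : ENNReal.ofReal lam = spectralRadius ℂ
      ((((adjMatrix ℝ s r).transpose).submatrix
          (Subtype.val : {v // HasInfinitePath s r v} → V)
          (Subtype.val : {v // HasInfinitePath s r v} → V)).map
        (Complex.ofReal ·)))
    (τ₁ : {v // HasInfinitePath s r v} → ℝ)
    (hτ₁_nonneg : ∀ x, 0 ≤ τ₁ x)
    (hτ₁_sum : ∑ x : {v // HasInfinitePath s r v}, τ₁ x = 1)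
    (hτ₁_eig : (((adjMatrix ℝ s r).transpose).submatrix
        (Subtype.val : {v // HasInfinitePath s r v} → V)
        (Subtype.val : {v // HasInfinitePath s r v} → V)).mulVec τ₁
      = lam • τ₁) :
    (∀ v : V, 0 ≤ extendByZero (HasInfinitePath s r) τ₁ v) ∧
    (∑ v : V, extendByZero (HasInfinitePath s r) τ₁ v) = 1 ∧
    (∀ w : V, ¬ IsSink s w →
      (adjMatrix ℝ s r).transpose.mulVec (extendByZero (HasInfinitePath s r) τ₁) w
        = lam * extendByZero (HasInfinitePath s r) τ₁ w) ∧
    extendByZero (HasInfinitePath s r) τ₁ ∈ KMSVectors s r (Real.log lam) := by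
  have hnonneg : ∀ v : V, 0 ≤ extendByZero (HasInfinitePath s r) τ₁ v := by
    intro v
    unfold extendByZero
    split_ifs with h
    · exact hτ₁_nonneg _
    · exact le_rfl
  have hsum : ∑ v : V, extendByZero (HasInfinitePath s r) τ₁ v = 1 := by
    simpa [hτ₁_sum] using sum_mul_extendByZero (HasInfinitePath s r) 1 τ₁
  have heig : ∀ w : V, ¬ IsSink s w →
      (adjMatrix ℝ s r).transpose.mulVec (extendByZero (HasInfinitePath s r) τ₁) w
        = lam * extendByZero (HasInfinitePath s r) τ₁ w := by
    intro w _
    rw [Matrix.mulVec, dotProduct, sum_mul_extendByZero]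
    by_cases hw : HasInfinitePath s r w
    · simpa [Matrix.mulVec, dotProduct, extendByZero, hw] using congrFun hτ₁_eig ⟨w, hw⟩
    · rw [extendByZero, dif_neg hw, mul_zero]
      refine Finset.sum_eq_zero fun x _ => ?_
      have hx : ¬ ∃ e : E, s e = w ∧ r e = x := by
        rintro ⟨e, rfl, he⟩
        exact hw (.of_range e (he ▸ x.2))
      simp [adjMatrix, hx]
  have : Nonempty {v // HasInfinitePath s r v} := by
    by_contra hempty
    rw [not_nonempty_iff] at hempty
    simp at hτ₁_sum
  have hone : 1 ≤ lam := by
    rw [← ENNReal.one_le_ofReal, hlam]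
    refine one_le_spectralRadius_of_one_le_mulVec_one _
      (fun i j => adjMatrix_nonneg s r j i) fun i => ?_
    obtain ⟨e, he, hr⟩ := i.2.exists_edge
    have hentry : adjMatrix ℝ s r (r e) i = 1 := by
      simp only [adjMatrix, Matrix.of_apply]
      exact if_pos ⟨e, he, rfl⟩
    simp only [Matrix.mulVec, dotProduct, Matrix.submatrix_apply, Matrix.transpose_apply,
      Pi.one_apply, mul_one]
    rw [← hentry]
    exact Finset.single_le_sum (f := fun x : {v // HasInfinitePath s r v} =>
      adjMatrix ℝ s r x i) (fun x _ => adjMatrix_nonneg s r x i)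
      (Finset.mem_univ ⟨r e, hr⟩)
  refine ⟨hnonneg, hsum, heig, hnonneg, hsum, ?_⟩
  rwa [Real.exp_log (by linarith)]
end
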